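/- arXiv:1002.0230 — 2 statements merged into one kernel-verified Lean document; each statement's English description precedes it below -/
import Mathlib

section
/- Let {Φ_n} be a sequence of positive linear trace-non-increasing maps from 𝔗(ℋ) to 𝔗(ℋ') converging strongly to a map Φ_0 (that is, Φ_n(ρ) → Φ_0(ρ) in trace norm for every state ρ). The following are equivalent: (i) lim_{n→∞} H_{Φ_n}(A_n) = H_{Φ_0}(A_0) < +∞ for every sequence {A_n} of rank-≤1 positive trace-class operators converging to an operator A_0; (ii) for every sequence {A_n} ⊂ 𝔗₊(ℋ) converging to A_0 with lim_{n→∞} H(A_n) = H(A_0) < +∞, one has lim_{n→∞} H_{Φ_n}(A_n) = H_{Φ_0}(A_0) < +∞. -/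
open scoped ENNReal NNReal
open Filter Topology Classical
attribute [local instance] Classical.propDecidable

noncomputable section

namespace QIT

section Defs

variable {E F G : Type*}
variable [NormedAddCommGroup E] [InnerProductSpace ℂ E] [CompleteSpace E]
variable [NormedAddCommGroup F] [InnerProductSpace ℂ F] [CompleteSpace F]
variable [NormedAddCommGroup G] [InnerProductSpace ℂ G] [CompleteSpace G]

/-- The real part of `⟪x, A x⟫`. -/
def qf (A : E →L[ℂ] E) (x : E) : ℝ := (inner ℂ x (A x) : ℂ).re

/-- The trace of a positive operator, as the supremum of finite diagonal sums over
finite orthonormal families.  For positive operators this coincides with the usual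
trace (with value `∞` when the operator is not trace class). -/
def traceENN (A : E →L[ℂ] E) : ℝ≥0∞ :=
  ⨆ (n : ℕ) (e : Fin n → E) (_ : Orthonormal ℂ e), ∑ i, ENNReal.ofReal (qf A (e i))

/-- The trace norm `‖A‖₁`, as the supremum of `∑ |⟪e i, A (f i)⟫|` over pairs of finite
orthonormal families; it is finite exactly on trace-class operators. -/
def traceNorm (A : E →L[ℂ] E) : ℝ≥0∞ :=
  ⨆ (n : ℕ) (e : Fin n → E) (f : Fin n → E) (_ : Orthonormal ℂ e) (_ : Orthonormal ℂ f),
    ∑ i, ENNReal.ofReal ‖(inner ℂ (e i) (A (f i)) : ℂ)‖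

/-- `A` is a trace-class operator. -/
def IsTC (A : E →L[ℂ] E) : Prop := traceNorm A ≠ ∞

/-- The cone `𝔗₊(E)` of positive trace-class operators. -/
def posTC (E : Type*) [NormedAddCommGroup E] [InnerProductSpace ℂ E] [CompleteSpace E] :
    Set (E →L[ℂ] E) := {A | A.IsPositive ∧ IsTC A}

/-- The set `𝔖(E)` of states (density operators). -/
def states (E : Type*) [NormedAddCommGroup E] [InnerProductSpace ℂ E] [CompleteSpace E] :
    Set (E →L[ℂ] E) := {A | A.IsPositive ∧ traceENN A = 1}

/-- The extended classical entropy `H({x_i}) = ∑ η(x_i) − η(∑ x_i)` of a nonnegative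
summable family, written in the equivalent homogeneous form `(∑ x) · H({x_i/∑x})`. -/
def clEntropy {ι : Type*} (x : ι → ℝ) : ℝ≥0∞ :=
  ENNReal.ofReal (∑' i, x i) *
    ∑' i, ENNReal.ofReal (Real.negMulLog (x i / (∑' j, x j)))

/-- An orthonormal subset with dense span (an orthonormal basis, as a set). -/
def IsONB (s : Set E) : Prop :=
  Orthonormal ℂ ((↑) : s → E) ∧ Dense ((Submodule.span ℂ s : Submodule ℂ E) : Set E)

/-- The quantum (von Neumann) entropy `H(A) = Tr η(A) − η(Tr A)` of a positive trace-class
operator, realized as the infimum over all orthonormal bases of the classical entropy of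
the diagonal of `A` (the infimum is attained on an eigenbasis of `A`). -/
def qEntropy (A : E →L[ℂ] E) : ℝ≥0∞ :=
  ⨅ (s : Set E) (_ : IsONB s), clEntropy fun v : s => qf A v

theorem exists_isONB (E : Type*) [NormedAddCommGroup E] [InnerProductSpace ℂ E]
    [CompleteSpace E] : ∃ s : Set E, IsONB s := by
  obtain ⟨w, b, hb⟩ := exists_hilbertBasis ℂ E
  refine ⟨w, ?_, ?_⟩
  · have h := b.orthonormal
    rwa [hb] at h
  · have h := b.dense_span
    rw [hb, Subtype.range_coe] at h
    rwa [Submodule.dense_iff_topologicalClosure_eq_top]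

/-- A fixed orthonormal basis (as a set). -/
def stdONB (E : Type*) [NormedAddCommGroup E] [InnerProductSpace ℂ E] [CompleteSpace E] :
    Set E := (exists_isONB E).choose

/-- The `ℂ`-valued trace, computed in a fixed orthonormal basis; for trace-class
operators it does not depend on the choice of the basis. -/
def traceC (A : E →L[ℂ] E) : ℂ := ∑' v : stdONB E, (inner ℂ (v : E) (A v) : ℂ)

/-- Continuity (including finiteness) of an `ℝ≥0∞`-valued function on a subset of
operators, with respect to the trace-norm distance. -/
def ContOn (f : (E →L[ℂ] E) → ℝ≥0∞) (𝒜 : Set (E →L[ℂ] E)) : Prop :=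
  (∀ A ∈ 𝒜, f A ≠ ∞) ∧
  ∀ A ∈ 𝒜, ∀ ε : ℝ, 0 < ε → ∃ δ : ℝ, 0 < δ ∧
    ∀ B ∈ 𝒜, traceNorm (B - A) < ENNReal.ofReal δ → |(f B).toReal - (f A).toReal| < ε

/-- Continuity of a real-valued function on a subset of operators with respect to the
trace-norm distance. -/
def RContOn (g : (E →L[ℂ] E) → ℝ) (𝒜 : Set (E →L[ℂ] E)) : Prop :=
  ∀ A ∈ 𝒜, ∀ ε : ℝ, 0 < ε → ∃ δ : ℝ, 0 < δ ∧
    ∀ B ∈ 𝒜, traceNorm (B - A) < ENNReal.ofReal δ → |g B - g A| < ε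

/-- Boundedness of an `ℝ≥0∞`-valued function on a set. -/
def BddOn (f : (E →L[ℂ] E) → ℝ≥0∞) (𝒜 : Set (E →L[ℂ] E)) : Prop :=
  ∃ C : ℝ, ∀ A ∈ 𝒜, f A ≤ ENNReal.ofReal C

/-- Convergence of a sequence of operators in the trace norm. -/
def TendstoTN (A : ℕ → (E →L[ℂ] E)) (A₀ : E →L[ℂ] E) : Prop :=
  ∀ ε : ℝ, 0 < ε → ∃ N : ℕ, ∀ n ≥ N, traceNorm (A n - A₀) < ENNReal.ofReal ε

/-- A positive linear map from the trace class of `E` to the trace class of `F`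
(the values of `toFun` outside the trace class are irrelevant). -/
structure TraceMap (E F : Type*) [NormedAddCommGroup E] [InnerProductSpace ℂ E]
    [CompleteSpace E] [NormedAddCommGroup F] [InnerProductSpace ℂ F] [CompleteSpace F] where
  toFun : (E →L[ℂ] E) → (F →L[ℂ] F)
  map_add : ∀ A B, IsTC A → IsTC B → toFun (A + B) = toFun A + toFun B
  map_smul : ∀ (c : ℂ) A, IsTC A → toFun (c • A) = c • toFun A
  maps_tc : ∀ A, IsTC A → IsTC (toFun A)
  pos : ∀ A, IsTC A → A.IsPositive → (toFun A).IsPositive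

/-- A trace-non-increasing map. -/
def TraceMap.TNI (Φ : TraceMap E F) : Prop :=
  ∀ A, IsTC A → A.IsPositive → traceENN (Φ.toFun A) ≤ traceENN A

/-- A trace-preserving map. -/
def TraceMap.TP (Φ : TraceMap E F) : Prop :=
  ∀ A, IsTC A → A.IsPositive → traceENN (Φ.toFun A) = traceENN A

/-- A map bounded with respect to the trace norm. -/
def TraceMap.Bounded (Φ : TraceMap E F) : Prop :=
  ∃ C : ℝ≥0, ∀ A, traceNorm (Φ.toFun A) ≤ (C : ℝ≥0∞) * traceNorm A

/-- The output entropy `H_Φ = H ∘ Φ`. -/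
def outEntropy (Φ : TraceMap E F) (A : E →L[ℂ] E) : ℝ≥0∞ := qEntropy (Φ.toFun A)

/-- The rank-one operator `|x⟩⟨x|`. -/
def rankOne (x : E) : E →L[ℂ] E := (innerSL ℂ x).smulRight x

/-- The rank-one operator `|x⟩⟨y|`. -/
def rankOneM (x y : E) : E →L[ℂ] E := (innerSL ℂ y).smulRight x

end Defs

section Defs2

variable {E F G : Type*}
variable [NormedAddCommGroup E] [InnerProductSpace ℂ E] [CompleteSpace E]
variable [NormedAddCommGroup F] [InnerProductSpace ℂ F] [CompleteSpace F]
variable [NormedAddCommGroup G] [InnerProductSpace ℂ G] [CompleteSpace G]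

/-- The completely positive map `A ↦ ∑ᵢ Vᵢ A Vᵢ*` defined by a sequence of Kraus
operators. -/
def krausMap (V : ℕ → (E →L[ℂ] F)) (A : E →L[ℂ] E) : F →L[ℂ] F :=
  ∑' i, V i ∘L A ∘L ContinuousLinearMap.adjoint (V i)

/-- The Kraus condition `∑ᵢ Vᵢ* Vᵢ ≤ I` (all partial sums are dominated by `I`). -/
def KrausTNI (V : ℕ → (E →L[ℂ] F)) : Prop :=
  ∀ n : ℕ,
    ((1 : E →L[ℂ] E) - ∑ i ∈ Finset.range n, ContinuousLinearMap.adjoint (V i) ∘L V i).IsPositive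

/-- The Kraus condition `∑ᵢ Vᵢ* Vᵢ = I` (strong convergence), i.e. trace preservation. -/
def KrausTP (V : ℕ → (E →L[ℂ] F)) : Prop :=
  ∀ x : E, HasSum (fun i => (ContinuousLinearMap.adjoint (V i)) (V i x)) x

/-- `(Φ, Φt)` is a complementary pair of quantum operations: for some Kraus
representation `Φ(·) = ∑ᵢ Vᵢ (·) Vᵢ*` and some orthonormal basis `{bᵢ}` of `G`,
`Φt(A) = ∑_{i,j} Tr[Vᵢ A Vⱼ*] |bᵢ⟩⟨bⱼ|` (characterized by its matrix entries). -/
def IsComplementaryPair (Φ : TraceMap E F) (Φt : TraceMap E G) : Prop :=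
  ∃ (V : ℕ → (E →L[ℂ] F)) (b : HilbertBasis ℕ ℂ G),
    KrausTNI V ∧
    (∀ A, IsTC A → Φ.toFun A = krausMap V A) ∧
    (∀ A, IsTC A → ∀ i j : ℕ,
      (inner ℂ (b i) (Φt.toFun A (b j)) : ℂ) =
        traceC (V i ∘L A ∘L ContinuousLinearMap.adjoint (V j)))

/-- A map (on trace-class operators) preserves continuity of the entropy:
its output entropy is continuous on every subset of the positive trace-class cone on
which the von Neumann entropy is continuous. -/
def PCE (Φf : (E →L[ℂ] E) → (F →L[ℂ] F)) : Prop :=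
  ∀ 𝒜 : Set (E →L[ℂ] E), 𝒜 ⊆ posTC E → ContOn qEntropy 𝒜 →
    ContOn (fun A => qEntropy (Φf A)) 𝒜

/-- `μ` is the sequence of nonzero eigenvalues (with multiplicities, possibly padded by
zeros) of the diagonalizable positive operator `T`, every vector orthogonal to the
eigenvectors being annihilated by `T`. -/
def IsEigenSeq (T : E →L[ℂ] E) (μ : ℕ → ℝ) : Prop :=
  ∃ e : ℕ → E,
    (∀ i j, i ≠ j → (inner ℂ (e i) (e j) : ℂ) = 0) ∧
    (∀ i, (μ i ≠ 0 → ‖e i‖ = 1) ∧ (μ i = 0 → e i = 0)) ∧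
    (∀ i, T (e i) = (μ i : ℂ) • e i) ∧
    (∀ x : E, (∀ i, (inner ℂ (e i) x : ℂ) = 0) → T x = 0)

/-- `ν` is the sequence of singular values of `V` (eigenvalues of `√(V*V)`,
equivalently `ν²` are the eigenvalues of `V*V`). -/
def IsSingularValues (V : E →L[ℂ] F) (ν : ℕ → ℝ) : Prop :=
  (∀ i, 0 ≤ ν i) ∧ IsEigenSeq (ContinuousLinearMap.adjoint V ∘L V) (fun i => ν i ^ 2)

/-- `∑ᵢ e^{−l/νᵢ²}`, the sum being taken over the indices with `νᵢ ≠ 0`. -/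
def expSum (ν : ℕ → ℝ) (l : ℝ) : ℝ≥0∞ :=
  ∑' i, if ν i = 0 then 0 else ENNReal.ofReal (Real.exp (-(l / ν i ^ 2)))

/-- `λ*(V) < ∞`: `V` is compact (automatic here) and `∑ᵢ e^{−l/νᵢ²} < ∞` for some
`l > 0`, where `{νᵢ}` are the singular values of `V`. -/
def LamStarFin (V : E →L[ℂ] F) : Prop :=
  ∃ ν : ℕ → ℝ, IsSingularValues V ν ∧ ∃ l : ℝ, 0 < l ∧ expSum ν l ≠ ∞

/-- `λ*(√S) < ∞` for a positive operator `S` (the singular values of `√S` are the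
square roots of the eigenvalues of `S`). -/
def LamStarSqrtFin (S : E →L[ℂ] E) : Prop :=
  ∃ ν : ℕ → ℝ, (∀ i, 0 ≤ ν i) ∧ IsEigenSeq S (fun i => ν i ^ 2) ∧
    ∃ l : ℝ, 0 < l ∧ expSum ν l ≠ ∞

/-- The value `λ*` associated to a sequence `ν` of singular values: the unique solution
of `∑ᵢ e^{−λ/νᵢ²} = 1` if it exists, and `inf{λ > 0 | ∑ᵢ e^{−λ/νᵢ²} < ∞}` otherwise. -/
def lamStarOf (ν : ℕ → ℝ) : ℝ≥0∞ :=
  if h : ∃ l : ℝ, expSum ν l = 1 then ENNReal.ofReal h.choose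
  else ⨅ (l : ℝ) (_ : 0 < l ∧ expSum ν l ≠ ∞), ENNReal.ofReal l

/-- The parameter `λ*(V) ∈ [0,∞]` of a bounded operator `V`. -/
def lamStar (V : E →L[ℂ] F) : ℝ≥0∞ :=
  if h : ∃ ν : ℕ → ℝ, IsSingularValues V ν then lamStarOf h.choose else ∞

/-- `rank A ≤ k`. -/
def rankLE (A : E →L[ℂ] E) (k : ℕ) : Prop :=
  Module.rank ℂ (LinearMap.range (A : E →ₗ[ℂ] E)) ≤ k

/-- The set `𝔗₊ᵏ(E)` of positive (trace-class) operators of rank at most `k`. -/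
def rankCone (E : Type*) [NormedAddCommGroup E] [InnerProductSpace ℂ E] [CompleteSpace E]
    (k : ℕ) : Set (E →L[ℂ] E) := {A | A.IsPositive ∧ rankLE A k}

/-- A decomposition of `A` into a countable convex combination of positive operators of
rank at most `k`. -/
structure Decomp (k : ℕ) (A : E →L[ℂ] E) where
  π : ℕ → ℝ
  op : ℕ → (E →L[ℂ] E)
  π_nonneg : ∀ i, 0 ≤ π i
  π_sum : HasSum π 1
  op_pos : ∀ i, (op i).IsPositive
  op_rank : ∀ i, rankLE (op i) k
  sum_eq : HasSum (fun i => π i • op i) A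

/-- The `k`-order approximator `H_Φᵏ` of the output entropy of `Φ`. -/
def kApprox (Φf : (E →L[ℂ] E) → (F →L[ℂ] F)) (k : ℕ) (A : E →L[ℂ] E) : ℝ≥0∞ :=
  ⨆ d : Decomp k A, ∑' i, ENNReal.ofReal (d.π i) * qEntropy (Φf (d.op i))

/-- The set of pure states (extreme points of `𝔖(E)`). -/
def pureStates (E : Type*) [NormedAddCommGroup E] [InnerProductSpace ℂ E]
    [CompleteSpace E] : Set (E →L[ℂ] E) := {A | ∃ x : E, ‖x‖ = 1 ∧ A = rankOne x}

end Defs2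

section Tensor

variable (E F G : Type*)
variable [NormedAddCommGroup E] [InnerProductSpace ℂ E] [CompleteSpace E]
variable [NormedAddCommGroup F] [InnerProductSpace ℂ F] [CompleteSpace F]
variable [NormedAddCommGroup G] [InnerProductSpace ℂ G] [CompleteSpace G]

/-- A realization of `G` as the Hilbert tensor product `E ⊗ F`, together with the
tensor product of (bounded) operators. -/
structure TensorData where
  tmul : E → F → G
  add_left : ∀ x y z, tmul (x + y) z = tmul x z + tmul y z
  add_right : ∀ x y z, tmul x (y + z) = tmul x y + tmul x z
  smul_left : ∀ (c : ℂ) x y, tmul (c • x) y = c • tmul x y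
  smul_right : ∀ (c : ℂ) x y, tmul x (c • y) = c • tmul x y
  inner_tmul : ∀ x x' y y',
    (inner ℂ (tmul x y) (tmul x' y') : ℂ) = (inner ℂ x x' : ℂ) * (inner ℂ y y' : ℂ)
  dense_span : Dense ((Submodule.span ℂ {z | ∃ x y, z = tmul x y} : Submodule ℂ G) : Set G)
  omul : (E →L[ℂ] E) → (F →L[ℂ] F) → (G →L[ℂ] G)
  omul_tmul : ∀ A B x y, omul A B (tmul x y) = tmul (A x) (B y)

end Tensor

set_option linter.unusedSectionVars false

section Scalar

/-- The function `x ↦ x log (S / x)` on `[0, S]`, whose sum over the terms of a family with total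
mass `S` is the homogeneous Shannon entropy of the family. -/
def entTerm (S x : ℝ≥0∞) : ℝ≥0∞ :=
  ENNReal.ofReal (x.toReal * (Real.log S.toReal - Real.log x.toReal))

/-- The homogeneous Shannon entropy of a family in `ℝ≥0∞` with finite sum. -/
def ent {ι : Type*} (p : ι → ℝ≥0∞) : ℝ≥0∞ := ∑' i, entTerm (∑' j, p j) (p i)

@[simp]
theorem entTerm_zero (S : ℝ≥0∞) : entTerm S 0 = 0 := by simp [entTerm]

@[simp]
theorem entTerm_self (S : ℝ≥0∞) : entTerm S S = 0 := by simp [entTerm]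

theorem mul_log_sub_log_le {x y : ℝ} (hx : 0 ≤ x) (hy : 0 < y) :
    x * (Real.log y - Real.log x) ≤ y - x := by
  rcases hx.eq_or_lt with rfl | hx
  · simpa using hy.le
  · have h := Real.log_le_sub_one_of_pos (div_pos hy hx)
    rw [Real.log_div hy.ne' hx.ne'] at h
    calc x * (Real.log y - Real.log x) ≤ x * (y / x - 1) := by gcongr
      _ = y - x := by field_simp

theorem entTerm_arg_nonneg {x S : ℝ} (hx : 0 ≤ x) (hxS : x ≤ S) :
    0 ≤ x * (Real.log S - Real.log x) := by
  rcases hx.eq_or_lt with rfl | hx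
  · simp
  · exact mul_nonneg hx.le (sub_nonneg.2 (Real.log_le_log hx hxS))

theorem entTerm_le_self (S x : ℝ≥0∞) (hxS : x ≤ S) (hS : S ≠ ∞) : entTerm S x ≤ S := by
  rcases eq_or_ne S 0 with rfl | h0
  · simp [nonpos_iff_eq_zero.1 hxS]
  · rw [entTerm]
    refine ENNReal.ofReal_le_of_le_toReal ?_
    have := mul_log_sub_log_le (ENNReal.toReal_nonneg (a := x)) (ENNReal.toReal_pos h0 hS)
    linarith [ENNReal.toReal_nonneg (a := x)]

/-- The tangent line bound for the concave function `entTerm P` at `p`. -/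
theorem entTerm_le_add_sub {q p Q P : ℝ≥0∞} (hqp : q ≤ p) (hpP : p ≤ P) (hQP : Q ≤ P)
    (hqQ : q ≤ Q) (hP : P ≠ ∞) : entTerm Q q ≤ entTerm P p + (p - q) := by
  rcases eq_or_ne q 0 with rfl | hq
  · simp
  have hp' : p ≠ ∞ := ne_top_of_le_ne_top hP hpP
  have hQ' : Q ≠ ∞ := ne_top_of_le_ne_top hP hQP
  have hq' : q ≠ ∞ := ne_top_of_le_ne_top hp' hqp
  lift q to ℝ≥0 using hq'
  lift p to ℝ≥0 using hp'
  lift Q to ℝ≥0 using hQ'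
  lift P to ℝ≥0 using hP
  norm_cast at hqp hpP hQP hqQ hq
  have hq0 : (0 : ℝ) < q := by positivity
  have hqp' : (q : ℝ) ≤ p := hqp
  have hpP' : (p : ℝ) ≤ P := hpP
  have hQP' : (Q : ℝ) ≤ P := hQP
  have hqQ' : (q : ℝ) ≤ Q := hqQ
  have e : ((p : ℝ≥0∞) - q) = ENNReal.ofReal ((p : ℝ) - q) := by
    rw [ENNReal.ofReal_sub _ hq0.le]; simp
  rw [e, entTerm, entTerm]
  simp only [ENNReal.coe_toReal]
  rw [← ENNReal.ofReal_add (entTerm_arg_nonneg (by positivity) hpP') (by linarith)]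
  apply ENNReal.ofReal_le_ofReal
  have h1 := mul_log_sub_log_le hq0.le (hq0.trans_le hqp')
  have h2 : Real.log Q ≤ Real.log P := Real.log_le_log (by linarith) hQP'
  have h3 : Real.log p ≤ Real.log P := Real.log_le_log (by linarith) hpP'
  nlinarith

theorem entTerm_le_add {q p Q P : ℝ≥0∞} (hqp : q ≤ p) (hpP : p ≤ P) (hQP : Q ≤ P)
    (hqQ : q ≤ Q) (hP : P ≠ ∞) : entTerm Q q ≤ entTerm P p + p :=
  (entTerm_le_add_sub hqp hpP hQP hqQ hP).trans (by gcongr; exact tsub_le_self)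

/-- Jensen's inequality for the concave function `entTerm S` vanishing at zero. -/
theorem tsum_mul_entTerm_le {κ : Type*} {S : ℝ≥0∞} (hS : S ≠ ∞) (W μ : κ → ℝ≥0∞)
    (hW : ∑' k, W k ≤ 1) (hμ : ∀ k, μ k ≤ S) :
    ∑' k, W k * entTerm S (μ k) ≤ entTerm S (∑' k, W k * μ k) := by
  set l := ∑' k, W k * μ k with hl
  have hlS : l ≤ S := by
    calc l ≤ ∑' k, W k * S := ENNReal.tsum_le_tsum fun k => by gcongr; exact hμ k
      _ = (∑' k, W k) * S := ENNReal.tsum_mul_right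
      _ ≤ 1 * S := by gcongr
      _ = S := one_mul S
  have hl' : l ≠ ∞ := ne_top_of_le_ne_top hS hlS
  rcases eq_or_ne l 0 with h0 | h0
  · rw [hl, ENNReal.tsum_eq_zero] at h0
    have : ∀ k, W k * entTerm S (μ k) = 0 := fun k => by
      rcases mul_eq_zero.1 (h0 k) with h | h <;> simp [h]
    simp [this]
  have hl0 : 0 < l.toReal := ENNReal.toReal_pos h0 hl'
  have hlS' : l.toReal ≤ S.toReal := ENNReal.toReal_mono hS hlS
  set L : ℝ≥0∞ := ENNReal.ofReal (Real.log S.toReal - Real.log l.toReal) with hL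
  have hL0 : 0 ≤ Real.log S.toReal - Real.log l.toReal :=
    sub_nonneg.2 (Real.log_le_log hl0 hlS')
  have hlL : entTerm S l = l * L := by
    rw [entTerm, ENNReal.ofReal_mul hl0.le, ENNReal.ofReal_toReal hl']
  have key : ∀ k, entTerm S (μ k) + μ k ≤ μ k * L + l := fun k => by
    have hm' : μ k ≠ ∞ := ne_top_of_le_ne_top hS (hμ k)
    have hmS : (μ k).toReal ≤ S.toReal := ENNReal.toReal_mono hS (hμ k)
    have hm0 := ENNReal.toReal_nonneg (a := μ k)
    calc entTerm S (μ k) + μ k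
        = ENNReal.ofReal ((μ k).toReal * (Real.log S.toReal - Real.log (μ k).toReal) +
            (μ k).toReal) := by
          rw [ENNReal.ofReal_add (entTerm_arg_nonneg hm0 hmS) hm0, ENNReal.ofReal_toReal hm',
            entTerm]
      _ ≤ ENNReal.ofReal ((μ k).toReal * (Real.log S.toReal - Real.log l.toReal) + l.toReal) := by
          apply ENNReal.ofReal_le_ofReal
          have := mul_log_sub_log_le hm0 hl0
          nlinarith
      _ = μ k * L + l := by
          rw [ENNReal.ofReal_add (mul_nonneg hm0 hL0) hl0.le, ENNReal.ofReal_mul hm0,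
            ENNReal.ofReal_toReal hm', ENNReal.ofReal_toReal hl']
  have hsum : ∑' k, W k * entTerm S (μ k) + l ≤ l * L + l := by
    calc ∑' k, W k * entTerm S (μ k) + l = ∑' k, W k * (entTerm S (μ k) + μ k) := by
          simp_rw [mul_add]; rw [ENNReal.tsum_add]
      _ ≤ ∑' k, W k * (μ k * L + l) := ENNReal.tsum_le_tsum fun k => mul_le_mul_right (key k) _
      _ = l * L + (∑' k, W k) * l := by
          simp_rw [mul_add, ← mul_assoc]
          rw [ENNReal.tsum_add, ENNReal.tsum_mul_right, ENNReal.tsum_mul_right]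
      _ ≤ l * L + 1 * l := by gcongr
      _ = l * L + l := by rw [one_mul]
  rw [hlL]
  exact (ENNReal.add_le_add_iff_right hl').1 hsum

/-- Schur concavity of the entropy. -/
theorem tsum_entTerm_le_of_substochastic {ι κ : Type*} {S : ℝ≥0∞} (hS : S ≠ ∞)
    (lam : ι → ℝ≥0∞) (μ : κ → ℝ≥0∞) (W : ι → κ → ℝ≥0∞)
    (hlam : ∀ i, lam i = ∑' k, W i k * μ k) (hrow : ∀ i, ∑' k, W i k ≤ 1)
    (hcol : ∀ k, μ k ≠ 0 → ∑' i, W i k = 1) (hμ : ∀ k, μ k ≤ S) :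
    ∑' k, entTerm S (μ k) ≤ ∑' i, entTerm S (lam i) := by
  calc ∑' k, entTerm S (μ k) = ∑' k, (∑' i, W i k) * entTerm S (μ k) := by
        refine tsum_congr fun k => ?_
        rcases eq_or_ne (μ k) 0 with h | h
        · simp [h]
        · rw [hcol k h, one_mul]
    _ = ∑' i, ∑' k, W i k * entTerm S (μ k) := by
        rw [ENNReal.tsum_comm]; simp_rw [ENNReal.tsum_mul_right]
    _ ≤ ∑' i, entTerm S (lam i) := ENNReal.tsum_le_tsum fun i => by
        rw [hlam i]; exact tsum_mul_entTerm_le hS _ _ (hrow i) hμ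

/-- The chain rule: splitting off the total mass `q` of a subfamily. -/
theorem tsum_entTerm_chain {ι : Type*} {Q : ℝ≥0∞} (hQ : Q ≠ ∞) (y : ι → ℝ≥0∞)
    (hy : ∑' i, y i ≤ Q) :
    ∑' i, entTerm Q (y i) = entTerm Q (∑' i, y i) + ent y := by
  set q := ∑' i, y i with hq
  have hq' : q ≠ ∞ := ne_top_of_le_ne_top hQ hy
  rcases eq_or_ne q 0 with h0 | h0
  · have : ∀ i, y i = 0 := by rw [hq, ENNReal.tsum_eq_zero] at h0; exact h0
    simp [this, h0, ent]
  have hq0 : 0 < q.toReal := ENNReal.toReal_pos h0 hq'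
  have hqQ : q.toReal ≤ Q.toReal := ENNReal.toReal_mono hQ hy
  have hL : 0 ≤ Real.log Q.toReal - Real.log q.toReal := sub_nonneg.2 (Real.log_le_log hq0 hqQ)
  have key : ∀ i, entTerm Q (y i) =
      y i * ENNReal.ofReal (Real.log Q.toReal - Real.log q.toReal) + entTerm q (y i) := fun i => by
    have hle : y i ≤ q := ENNReal.le_tsum i
    have hy' : y i ≠ ∞ := ne_top_of_le_ne_top hq' hle
    have h1 : (y i).toReal ≤ q.toReal := ENNReal.toReal_mono hq' hle
    have hy0 := ENNReal.toReal_nonneg (a := y i)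
    nth_rw 2 [← ENNReal.ofReal_toReal hy']
    rw [entTerm, entTerm, ← ENNReal.ofReal_mul hy0,
      ← ENNReal.ofReal_add (mul_nonneg hy0 hL) (entTerm_arg_nonneg hy0 h1)]
    congr 1; ring
  simp_rw [key]
  rw [ENNReal.tsum_add, ENNReal.tsum_mul_right, ← hq, ent, ← hq]
  congr 1
  rw [entTerm, ENNReal.ofReal_mul hq0.le, ENNReal.ofReal_toReal hq']

theorem tendsto_entTerm {α : Type*} {l : Filter α} {S p : α → ℝ≥0∞} {S₀ p₀ : ℝ≥0∞}
    (hS : Tendsto S l (𝓝 S₀)) (hp : Tendsto p l (𝓝 p₀)) (hle : ∀ a, p a ≤ S a)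
    (hle₀ : p₀ ≤ S₀) (hS₀ : S₀ ≠ ∞) :
    Tendsto (fun a => entTerm (S a) (p a)) l (𝓝 (entTerm S₀ p₀)) := by
  rcases eq_or_ne S₀ 0 with rfl | h0
  · have : p₀ = 0 := by simpa using hle₀
    subst this
    rw [entTerm_zero]
    refine tendsto_of_tendsto_of_tendsto_of_le_of_le' tendsto_const_nhds hS
      (Eventually.of_forall fun _ => bot_le) ?_
    filter_upwards [hS.eventually (gt_mem_nhds (show (0 : ℝ≥0∞) < 1 by simp))] with a ha
    exact entTerm_le_self _ _ (hle a) (ne_top_of_lt ha)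
  · have hp₀ : p₀ ≠ ∞ := ne_top_of_le_ne_top hS₀ hle₀
    have hSr : Tendsto (fun a => (S a).toReal) l (𝓝 S₀.toReal) :=
      (ENNReal.tendsto_toReal hS₀).comp hS
    have hpr : Tendsto (fun a => (p a).toReal) l (𝓝 p₀.toReal) :=
      (ENNReal.tendsto_toReal hp₀).comp hp
    have h1 := (hpr.mul (hSr.log (ENNReal.toReal_pos h0 hS₀).ne')).add
      ((Real.continuous_negMulLog.tendsto _).comp hpr)
    have := ENNReal.tendsto_ofReal h1
    refine (this.congr fun a => ?_).trans_eq ?_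
    · simp only [entTerm, Function.comp, Real.negMulLog]; congr 1; ring
    · simp only [entTerm, Real.negMulLog]; congr 2; ring

theorem exists_tendsto_ultrafilter {α X : Type*} [TopologicalSpace X] [CompactSpace X]
    (U : Ultrafilter α) (f : α → X) : ∃ x, Tendsto f U (𝓝 x) :=
  ⟨_, (U.map f).le_nhds_lim⟩

/-- Fatou's lemma for series in `ℝ≥0∞`. -/
theorem tsum_le_of_tendsto {α ι : Type*} {l : Filter α} [l.NeBot] {f : α → ι → ℝ≥0∞}
    {f₀ : ι → ℝ≥0∞} {L : ℝ≥0∞} (hf : ∀ i, Tendsto (fun a => f a i) l (𝓝 (f₀ i)))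
    (hL : Tendsto (fun a => ∑' i, f a i) l (𝓝 L)) : ∑' i, f₀ i ≤ L := by
  rw [ENNReal.tsum_eq_iSup_sum]
  refine iSup_le fun F => le_of_tendsto_of_tendsto' (tendsto_finsetSum F fun i _ => hf i) hL ?_
  exact fun a => ENNReal.sum_le_tsum F

/-- Pratt's generalized dominated convergence theorem for series in `ℝ≥0∞`. -/
theorem tendsto_tsum_of_dominated_tendsto {α ι : Type*} {l : Filter α} {f g : α → ι → ℝ≥0∞}
    {f₀ g₀ : ι → ℝ≥0∞} (hf : ∀ i, Tendsto (fun a => f a i) l (𝓝 (f₀ i)))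
    (hg : ∀ i, Tendsto (fun a => g a i) l (𝓝 (g₀ i)))
    (hfg : ∀ᶠ a in l, ∀ i, f a i ≤ g a i)
    (hsum : Tendsto (fun a => ∑' i, g a i) l (𝓝 (∑' i, g₀ i))) (hfin : ∑' i, g₀ i ≠ ∞) :
    Tendsto (fun a => ∑' i, f a i) l (𝓝 (∑' i, f₀ i)) := by
  rw [tendsto_iff_ultrafilter]
  intro U hU
  replace hf := fun i => (hf i).mono_left hU
  replace hg := fun i => (hg i).mono_left hU
  replace hsum := hsum.mono_left hU
  replace hfg := hU hfg
  have hle₀ : ∀ i, f₀ i ≤ g₀ i := fun i =>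
    le_of_tendsto_of_tendsto (hf i) (hg i) (by filter_upwards [hfg] with a ha using ha i)
  have hg₀ : ∀ i, g₀ i ≠ ∞ := fun i => ne_top_of_le_ne_top hfin (ENNReal.le_tsum i)
  obtain ⟨L, hL⟩ := exists_tendsto_ultrafilter U fun a => ∑' i, f a i
  obtain ⟨M, hM⟩ := exists_tendsto_ultrafilter U fun a => ∑' i, (g a i - f a i)
  have h1 := tsum_le_of_tendsto hf hL
  have h2 := tsum_le_of_tendsto (fun i => ENNReal.Tendsto.sub (hg i) (hf i) (Or.inl (hg₀ i))) hM
  have h3 : L + M = ∑' i, g₀ i := by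
    refine tendsto_nhds_unique ((hL.add hM).congr' ?_) hsum
    filter_upwards [hfg] with a ha
    rw [← ENNReal.tsum_add]
    exact tsum_congr fun i => add_tsub_cancel_of_le (ha i)
  have h4 : ∑' i, f₀ i + ∑' i, (g₀ i - f₀ i) = ∑' i, g₀ i := by
    rw [← ENNReal.tsum_add]
    exact tsum_congr fun i => add_tsub_cancel_of_le (hle₀ i)
  have h5 : L ≤ ∑' i, f₀ i := by
    have hfin' : ∑' i, (g₀ i - f₀ i) ≠ ∞ :=
      ne_top_of_le_ne_top hfin (by rw [← h4]; exact le_add_self)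
    refine (ENNReal.add_le_add_iff_right hfin').1 ?_
    rw [h4, ← h3]
    gcongr
  rwa [le_antisymm h5 h1] at hL

end Scalar

section Hilbert

variable {E : Type*} [NormedAddCommGroup E] [InnerProductSpace ℂ E] [CompleteSpace E]

/-- `A = ∑ⱼ |xⱼ⟩⟨xⱼ|`, in the sense of quadratic forms. -/
def IsDec {ι : Type*} (A : E →L[ℂ] E) (x : ι → E) : Prop :=
  ∀ y, ∑' j, ‖(inner ℂ (x j) y : ℂ)‖ₑ ^ 2 = ENNReal.ofReal (qf A y)

theorem enorm_sq_eq_ofReal {V : Type*} [NormedAddCommGroup V] (x : V) :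
    ‖x‖ₑ ^ 2 = ENNReal.ofReal (‖x‖ ^ 2) := by
  rw [← ofReal_norm, ENNReal.ofReal_pow (norm_nonneg x)]

theorem enorm_inner_comm (x y : E) : ‖(inner ℂ x y : ℂ)‖ₑ = ‖(inner ℂ y x : ℂ)‖ₑ := by
  rw [← ofReal_norm, ← ofReal_norm, norm_inner_symm]

theorem enorm_inner_sq_le (x y : E) : ‖(inner ℂ x y : ℂ)‖ₑ ^ 2 ≤ ‖x‖ₑ ^ 2 * ‖y‖ₑ ^ 2 := by
  rw [← mul_pow, ← ofReal_norm, ← ofReal_norm, ← ofReal_norm,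
    ← ENNReal.ofReal_mul (norm_nonneg x)]
  gcongr
  exact norm_inner_le_norm x y

theorem tsum_enorm_inner_sq {s : Set E} (hs : IsONB s) (y : E) :
    ∑' v : s, ‖(inner ℂ (v : E) y : ℂ)‖ₑ ^ 2 = ‖y‖ₑ ^ 2 := by
  have hd : ⊤ ≤ (Submodule.span ℂ (Set.range ((↑) : s → E))).topologicalClosure := by
    rw [Subtype.range_coe, ← Submodule.dense_iff_topologicalClosure_eq_top.1 hs.2]
  set b := HilbertBasis.mk hs.1 hd with hb
  have h := (b.hasSum_inner_mul_inner y y).mapL Complex.reCLM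
  have h2 : HasSum (fun v : s => ‖(inner ℂ (v : E) y : ℂ)‖ ^ 2) (‖y‖ ^ 2) := by
    convert h using 1
    · ext v
      change _ = RCLike.re (inner ℂ y (b v) * inner ℂ (b v) y : ℂ)
      rw [inner_mul_symm_re_eq_norm, norm_mul, norm_inner_symm y, hb, HilbertBasis.coe_mk, sq]
    · rw [inner_self_eq_norm_sq_to_K]
      simp [← Complex.ofReal_pow]
  simp_rw [enorm_sq_eq_ofReal]
  rw [← ENNReal.ofReal_tsum_of_nonneg (fun _ => by positivity) h2.summable, h2.tsum_eq]

theorem tsum_enorm_inner_sq_le {ι : Type*} {e : ι → E} (he : Orthonormal ℂ e) (y : E) :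
    ∑' i, ‖(inner ℂ (e i) y : ℂ)‖ₑ ^ 2 ≤ ‖y‖ₑ ^ 2 := by
  simp_rw [enorm_sq_eq_ofReal]
  rw [← ENNReal.ofReal_tsum_of_nonneg (fun _ => by positivity) (he.inner_products_summable y)]
  exact ENNReal.ofReal_le_ofReal (he.tsum_inner_products_le y)

/-- Bessel's inequality for an orthogonal family. -/
theorem tsum_enorm_inner_sq_div_le {ι : Type*} {w : ι → E}
    (hw : ∀ i j, i ≠ j → (inner ℂ (w i) (w j) : ℂ) = 0) (y : E) :
    ∑' i, ‖(inner ℂ (w i) y : ℂ)‖ₑ ^ 2 / ‖w i‖ₑ ^ 2 ≤ ‖y‖ₑ ^ 2 := by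
  set t : Set ι := {i | w i ≠ 0} with ht
  have hsupp : Function.support (fun i => ‖(inner ℂ (w i) y : ℂ)‖ₑ ^ 2 / ‖w i‖ₑ ^ 2) ⊆ t := by
    intro i hi hi'
    have h0 : w i = 0 := hi'
    simp [h0] at hi
  rw [← tsum_subtype_eq_of_support_subset hsupp]
  set e : t → E := fun i => ((‖w i‖⁻¹ : ℝ) : ℂ) • w i with he_def
  have he : Orthonormal ℂ e := by
    constructor
    · intro i
      have : ‖w i‖ ≠ 0 := norm_ne_zero_iff.2 i.2
      rw [he_def, norm_smul, Complex.norm_real, norm_inv, norm_norm, inv_mul_cancel₀ this]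
    · intro i j hij
      simp [he_def, inner_smul_left, inner_smul_right, hw i j (fun h => hij (Subtype.ext h))]
  refine le_trans (le_of_eq (tsum_congr fun i => ?_)) (tsum_enorm_inner_sq_le he y)
  have hpos : 0 < ‖w i‖ := norm_pos_iff.2 i.2
  rw [enorm_sq_eq_ofReal, enorm_sq_eq_ofReal, enorm_sq_eq_ofReal,
    ← ENNReal.ofReal_div_of_pos (by positivity)]
  congr 1
  rw [he_def, inner_smul_left, norm_mul]
  simp only [Complex.conj_ofReal, Complex.norm_real, norm_inv, norm_norm]
  field_simp

theorem tsum_enorm_inner_sq_le_mul {ι : Type*} {w : ι → E} {M : ℝ≥0∞}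
    (hw : ∀ i j, i ≠ j → (inner ℂ (w i) (w j) : ℂ) = 0) (hM : ∀ i, ‖w i‖ₑ ^ 2 ≤ M) (y : E) :
    ∑' i, ‖(inner ℂ (w i) y : ℂ)‖ₑ ^ 2 ≤ M * ‖y‖ₑ ^ 2 := by
  calc ∑' i, ‖(inner ℂ (w i) y : ℂ)‖ₑ ^ 2
      ≤ ∑' i, M * (‖(inner ℂ (w i) y : ℂ)‖ₑ ^ 2 / ‖w i‖ₑ ^ 2) := by
        refine ENNReal.tsum_le_tsum fun i => ?_
        rcases eq_or_ne (w i) 0 with h | h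
        · simp [h]
        · calc ‖(inner ℂ (w i) y : ℂ)‖ₑ ^ 2
              = ‖w i‖ₑ ^ 2 * (‖(inner ℂ (w i) y : ℂ)‖ₑ ^ 2 / ‖w i‖ₑ ^ 2) := by
                rw [ENNReal.mul_div_cancel (by simpa using h) (by simp)]
            _ ≤ _ := by gcongr; exact hM i
    _ = M * ∑' i, ‖(inner ℂ (w i) y : ℂ)‖ₑ ^ 2 / ‖w i‖ₑ ^ 2 := ENNReal.tsum_mul_left
    _ ≤ M * ‖y‖ₑ ^ 2 := by gcongr; exact tsum_enorm_inner_sq_div_le hw y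

theorem qf_nonneg {A : E →L[ℂ] E} (hA : A.IsPositive) (y : E) : 0 ≤ qf A y :=
  hA.re_inner_nonneg_right y

theorem sum_qf_le_traceENN {ι : Type*} [Fintype ι] (A : E →L[ℂ] E) {e : ι → E}
    (he : Orthonormal ℂ e) : ∑ i, ENNReal.ofReal (qf A (e i)) ≤ traceENN A := by
  have h := he.comp _ (Fintype.equivFin ι).symm.injective
  refine le_trans (le_of_eq ?_)
    (le_iSup_of_le (Fintype.card ι) (le_iSup_of_le _ (le_iSup_of_le h le_rfl)))
  exact ((Fintype.equivFin ι).symm.sum_comp fun i => ENNReal.ofReal (qf A (e i))).symm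

theorem IsDec.tsum_qf {ι : Type*} {A : E →L[ℂ] E} {x : ι → E} (h : IsDec A x) {s : Set E}
    (hs : IsONB s) : ∑' v : s, ENNReal.ofReal (qf A v) = ∑' j, ‖x j‖ₑ ^ 2 := by
  simp_rw [← h _]
  rw [ENNReal.tsum_comm]
  refine tsum_congr fun j => ?_
  simp_rw [enorm_inner_comm (x j)]
  exact tsum_enorm_inner_sq hs (x j)

theorem IsDec.traceENN_eq {ι : Type*} {A : E →L[ℂ] E} {x : ι → E} (h : IsDec A x) :
    traceENN A = ∑' j, ‖x j‖ₑ ^ 2 := by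
  apply le_antisymm
  · refine iSup_le fun n => iSup_le fun e => iSup_le fun he => ?_
    simp_rw [← h _]
    rw [← tsum_fintype (L := SummationFilter.unconditional _), ENNReal.tsum_comm]
    refine ENNReal.tsum_le_tsum fun j => ?_
    simp_rw [enorm_inner_comm (x j)]
    exact tsum_enorm_inner_sq_le he (x j)
  · obtain ⟨s, hs⟩ := exists_isONB E
    rw [← h.tsum_qf hs, ENNReal.tsum_eq_iSup_sum]
    refine iSup_le fun F => ?_
    rw [← Finset.sum_coe_sort]
    exact sum_qf_le_traceENN A (hs.1.comp ((↑) : F → s) Subtype.val_injective)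

theorem isCompactOperator_of_traceENN {A : E →L[ℂ] E} (hA : A.IsPositive)
    (hT : traceENN A ≠ ∞) : IsCompactOperator A := by
  have hA' : 0 ≤ A := A.nonneg_iff_isPositive.2 hA
  set R : E →L[ℂ] E := CFC.sqrt A with hR
  have hRR : R * R = A := CFC.sqrt_mul_sqrt_self A
  have hRsa : R.IsPositive := R.nonneg_iff_isPositive.1 (CFC.sqrt_nonneg A)
  have hnorm : ∀ y, ‖R y‖ ^ 2 = qf A y := fun y => by
    rw [qf, ← hRR, mul_apply_eq_comp, ← hRsa.inner_left_eq_inner_right,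
      inner_self_eq_norm_sq_to_K]
    simp [← Complex.ofReal_pow]
  suffices hRc : IsCompactOperator R by
    rw [← hRR]
    exact hRc.clm_comp R
  have happrox : ∀ ε : ℝ, 0 < ε → ∃ S : E →L[ℂ] E, IsCompactOperator S ∧ ‖R - S‖ ≤ ε := by
    intro ε hε
    obtain ⟨n, e, he, hsum⟩ : ∃ (n : ℕ) (e : Fin n → E), Orthonormal ℂ e ∧
        traceENN A ≤ ∑ i, ENNReal.ofReal (qf A (e i)) + ENNReal.ofReal (ε ^ 2) := by
      rcases eq_or_ne (traceENN A) 0 with h0 | h0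
      · exact ⟨0, Fin.elim0, by simp [Orthonormal], by simp [h0]⟩
      have h1 := ENNReal.sub_lt_self hT h0 (ENNReal.ofReal_pos.2 (pow_pos hε 2)).ne'
      nth_rw 2 [traceENN] at h1
      simp only [lt_iSup_iff] at h1
      obtain ⟨n, e, he, h⟩ := h1
      exact ⟨n, e, he, tsub_le_iff_right.1 h.le⟩
    set K : Submodule ℂ E := Submodule.span ℂ (Set.range e) with hK
    have : FiniteDimensional ℂ K := FiniteDimensional.span_of_finite ℂ (Set.finite_range e)
    have hKperp : ∀ y ∈ Kᗮ, ‖R y‖ ≤ ε * ‖y‖ := by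
      intro y hy
      rcases eq_or_ne y 0 with rfl | hy0
      · simp
      have hny : 0 < ‖y‖ := norm_pos_iff.2 hy0
      set u : E := ((‖y‖⁻¹ : ℝ) : ℂ) • y with hu
      have hunorm : ‖u‖ = 1 := by
        rw [hu, norm_smul, Complex.norm_real, norm_inv, norm_norm, inv_mul_cancel₀ hny.ne']
      have heu : ∀ i, (inner ℂ (e i) u : ℂ) = 0 := fun i => by
        rw [hu, inner_smul_right, hy (e i) (Submodule.subset_span ⟨i, rfl⟩), mul_zero]
      set f : Option (Fin n) → E := fun o => o.elim u e with hf
      have hfo : Orthonormal ℂ f := by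
        constructor
        · rintro (_ | i)
          · exact hunorm
          · exact he.1 i
        · rintro (_ | i) (_ | j) hij
          · exact absurd rfl hij
          · exact inner_eq_zero_symm.1 (heu j)
          · exact heu i
          · exact he.2 fun h => hij (by rw [h])
      have h1 := sum_qf_le_traceENN A hfo
      rw [Fintype.sum_option] at h1
      simp only [hf, Option.elim] at h1
      have h2 := h1.trans hsum
      rw [add_comm] at h2
      have h3 := (ENNReal.add_le_add_iff_left
        (ENNReal.sum_ne_top.2 fun i _ => ENNReal.ofReal_ne_top)).1 h2
      rw [ENNReal.ofReal_le_ofReal_iff (by positivity), ← hnorm] at h3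
      have h4 : ‖R u‖ ≤ ε := (sq_le_sq₀ (norm_nonneg _) hε.le).1 h3
      rw [hu, map_smul, norm_smul, Complex.norm_real, norm_inv, norm_norm,
        inv_mul_le_iff₀ hny] at h4
      linarith [mul_comm ε ‖y‖]
    refine ⟨R ∘L K.starProjection, ?_, ?_⟩
    · have hc : IsCompactOperator K.orthogonalProjectionOnto := by
        have := FiniteDimensional.proper ℂ K
        exact isCompactOperator_of_locallyCompactSpace_dom _
      exact hc.clm_comp (R ∘L K.subtypeL)
    · refine ContinuousLinearMap.opNorm_le_bound _ hε.le fun x => ?_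
      have : (R - R ∘L K.starProjection) x = R (x - K.starProjection x) := by simp
      rw [this]
      refine (hKperp _ (K.sub_starProjection_mem_orthogonal x)).trans ?_
      gcongr
      have := K.norm_sq_eq_add_norm_sq_starProjection x
      have h' : Kᗮ.starProjection x = x - K.starProjection x := by
        rw [Submodule.starProjection_orthogonal]; simp
      rw [h'] at this
      nlinarith [norm_nonneg x, norm_nonneg (x - K.starProjection x)]
  choose S hS hSn using fun n : ℕ => happrox (1 / (n + 1)) Nat.one_div_pos_of_nat
  refine isCompactOperator_of_tendsto (l := atTop) (F := S) ?_ (Eventually.of_forall hS)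
  rw [tendsto_iff_norm_sub_tendsto_zero]
  refine squeeze_zero (fun _ => norm_nonneg _) (fun n => ?_) tendsto_one_div_add_atTop_nhds_zero_nat
  rw [norm_sub_rev]
  exact hSn n

end Hilbert

section Spectral

variable {E : Type*} [NormedAddCommGroup E] [InnerProductSpace ℂ E] [CompleteSpace E]

/-- The entries of a summable family can be numbered in such a way that they decay. -/
theorem exists_injective_rank {ι : Type*} (p : ι → ℝ≥0∞) (hp : ∑' i, p i ≠ ∞) :
    ∃ r : Function.support p → ℕ, Function.Injective r ∧
      ∀ v, ((r v : ℝ≥0∞) + 1) * p v ≤ ∑' i, p i := by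
  have hc := Summable.countable_support_ennreal hp
  have : Countable (Function.support p) := hc.to_subtype
  obtain ⟨g, hg⟩ := exists_injective_nat (Function.support p)
  set T : Function.support p → Set (Function.support p) :=
    fun v => {w | p v < p w ∨ (p w = p v ∧ g w < g v)} with hT
  have hle : ∀ v, ∀ w ∈ T v, p v ≤ p w := by
    rintro v w (h | h)
    · exact h.le
    · exact h.1.ge
  have hps : ∑' v : Function.support p, p v = ∑' i, p i := tsum_subtype_support p
  have hfin : ∀ v, (T v).Finite := fun v =>
    (ENNReal.finite_const_le_of_tsum_ne_top (a := fun v : Function.support p => p v)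
      (by rw [hps]; exact hp) v.2).subset (hle v)
  have hself : ∀ v, v ∉ T v := by
    rintro v (h | h)
    · exact lt_irrefl _ h
    · exact lt_irrefl _ h.2
  have htrans : ∀ v w, w ∈ T v → (T w).ncard < (T v).ncard := by
    intro v w hw
    refine Set.ncard_lt_ncard ⟨?_, fun h => hself w (h hw)⟩ (hfin v)
    rintro u (hu | hu) <;> rcases hw with hw | hw
    · exact Or.inl (hw.trans hu)
    · exact Or.inl (hw.1 ▸ hu)
    · exact Or.inl (hu.1 ▸ hw)
    · exact Or.inr ⟨hu.1.trans hw.1, hu.2.trans hw.2⟩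
  refine ⟨fun v => (T v).ncard, ?_, ?_⟩
  · intro v w hvw
    by_contra hne
    have hg' : g v ≠ g w := fun h => hne (hg h)
    have : w ∈ T v ∨ v ∈ T w := by
      rcases lt_trichotomy (p v) (p w) with h | h | h
      · exact Or.inl (Or.inl h)
      · rcases lt_or_gt_of_ne hg' with h' | h'
        · exact Or.inr (Or.inr ⟨h, h'⟩)
        · exact Or.inl (Or.inr ⟨h.symm, h'⟩)
      · exact Or.inr (Or.inl h)
    rcases this with h | h
    · exact absurd hvw (htrans _ _ h).ne'
    · exact absurd hvw (htrans _ _ h).ne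
  · intro v
    change (((T v).ncard : ℝ≥0∞) + 1) * p v ≤ _
    rw [← hps]
    have hv : v ∉ (hfin v).toFinset := by simpa using hself v
    refine le_trans ?_ (ENNReal.sum_le_tsum (insert v (hfin v).toFinset))
    rw [Finset.sum_insert hv, add_mul, one_mul, add_comm, Set.ncard_eq_toFinset_card _ (hfin v),
      ← nsmul_eq_mul]
    gcongr
    exact Finset.card_nsmul_le_sum _ _ _ fun w hw => hle v w (by simpa using hw)

theorem exists_eigenbasis {A : E →L[ℂ] E} (hA : A.IsPositive) (hT : traceENN A ≠ ∞) :
    ∃ s : Set E, IsONB s ∧ ∀ v ∈ s, A v = ((qf A v : ℝ) : ℂ) • v := by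
  have hbot := ContinuousLinearMap.orthogonalComplement_iSup_eigenspaces_eq_bot
    (isCompactOperator_of_traceENN hA hT) hA.isSymmetric
  have hcl : ∀ μ : ℂ, IsClosed (Module.End.eigenspace (A : E →ₗ[ℂ] E) μ : Set E) := by
    intro μ
    have : (Module.End.eigenspace (A : E →ₗ[ℂ] E) μ : Set E) = {x | A x = μ • x} := by
      ext x; simp
    rw [this]
    exact isClosed_eq A.continuous (continuous_const_smul μ)
  have hcs : ∀ μ : ℂ, CompleteSpace (Module.End.eigenspace (A : E →ₗ[ℂ] E) μ) :=
    fun μ => (hcl μ).completeSpace_coe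
  choose w b hb using fun μ : ℂ =>
    exists_hilbertBasis ℂ (Module.End.eigenspace (A : E →ₗ[ℂ] E) μ)
  have hon := hA.isSymmetric.orthogonalFamily_eigenspaces.orthonormal_sigma_orthonormal
    (fun μ => (b μ).orthonormal)
  set f : (Σ μ, w μ) → E := fun a => ((b a.1 a.2 : Module.End.eigenspace (A : E →ₗ[ℂ] E) a.1) : E)
    with hf
  refine ⟨Set.range f, ⟨hon.toSubtypeRange, ?_⟩, ?_⟩
  · rw [Submodule.dense_iff_topologicalClosure_eq_top, Submodule.topologicalClosure_eq_top_iff,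
      ← le_bot_iff, ← hbot]
    intro y hy
    rw [Submodule.mem_orthogonal'] at hy
    have hker : ∀ μ : ℂ, ⊤ ≤ LinearMap.ker
        ((innerSL ℂ y).comp (Module.End.eigenspace (A : E →ₗ[ℂ] E) μ).subtypeL).toLinearMap := by
      intro μ
      rw [← (b μ).dense_span]
      refine Submodule.topologicalClosure_minimal _ ?_ (ContinuousLinearMap.isClosed_ker _)
      rw [Submodule.span_le]
      rintro _ ⟨i, rfl⟩
      simpa using hy _ (Submodule.subset_span ⟨⟨μ, i⟩, rfl⟩)
    have hle : (⨆ μ, Module.End.eigenspace (A : E →ₗ[ℂ] E) μ) ≤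
        LinearMap.ker (innerSL ℂ y).toLinearMap := by
      refine iSup_le fun μ v hv => ?_
      simpa using hker μ (Submodule.mem_top (x := ⟨v, hv⟩))
    rw [Submodule.mem_orthogonal']
    intro v hv
    simpa using hle hv
  · rintro _ ⟨a, rfl⟩
    have h1 : A (f a) = a.1 • f a := Module.End.mem_eigenspace_iff.1 (b a.1 a.2).2
    have h2 : (inner ℂ (f a) (A (f a)) : ℂ) = a.1 := by
      have hn : ‖f a‖ = 1 := hon.1 a
      rw [h1, inner_smul_right, inner_self_eq_norm_sq_to_K, hn]; simp
    have h3 : (a.1 : ℂ) = ((qf A (f a) : ℝ) : ℂ) := by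
      have := hA.inner_nonneg_right (f a)
      rw [qf, ← Complex.eq_re_of_ofReal_le (r := 0) (by simpa using this), h2]
    rw [h1, h3]

theorem IsONB.hasSum_inner_mul_inner {s : Set E} (hs : IsONB s) (x y : E) :
    HasSum (fun v : s => (inner ℂ x (v : E) * inner ℂ (v : E) y : ℂ)) (inner ℂ x y) := by
  have hd : ⊤ ≤ (Submodule.span ℂ (Set.range ((↑) : s → E))).topologicalClosure := by
    rw [Subtype.range_coe, ← Submodule.dense_iff_topologicalClosure_eq_top.1 hs.2]
  simpa using (HilbertBasis.mk hs.1 hd).hasSum_inner_mul_inner x y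

theorem tsum_eigenbasis {A : E →L[ℂ] E} (hA : A.IsPositive) {s : Set E} (hs : IsONB s)
    (hev : ∀ v ∈ s, A v = ((qf A v : ℝ) : ℂ) • v) (y : E) :
    ∑' v : s, ENNReal.ofReal (qf A v) * ‖(inner ℂ (v : E) y : ℂ)‖ₑ ^ 2
      = ENNReal.ofReal (qf A y) := by
  have h : HasSum _ (qf A y) := (hs.hasSum_inner_mul_inner y (A y)).mapL Complex.reCLM
  have h2 : HasSum (fun v : s => qf A v * ‖(inner ℂ (v : E) y : ℂ)‖ ^ 2) (qf A y) := by
    convert h using 1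
    ext v
    have h1 : (inner ℂ (v : E) (A y) : ℂ) = ((qf A v : ℝ) : ℂ) * inner ℂ (v : E) y := by
      rw [← hA.inner_left_eq_inner_right, hev v v.2, inner_smul_left, Complex.conj_ofReal]
    change _ = (inner ℂ y (v : E) * inner ℂ (v : E) (A y) : ℂ).re
    rw [h1, mul_left_comm, Complex.re_ofReal_mul]
    congr 1
    change _ = RCLike.re (inner ℂ y (v : E) * inner ℂ (v : E) y : ℂ)
    rw [inner_mul_symm_re_eq_norm, norm_mul, norm_inner_symm y, sq]
  simp_rw [enorm_sq_eq_ofReal, ← ENNReal.ofReal_mul (qf_nonneg hA _)]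
  rw [← ENNReal.ofReal_tsum_of_nonneg (fun v => mul_nonneg (qf_nonneg hA _) (by positivity))
    h2.summable, h2.tsum_eq]

theorem enorm_sqrt_smul_sq {a : ℝ} (ha : 0 ≤ a) (v : E) :
    ‖((√a : ℝ) : ℂ) • v‖ₑ ^ 2 = ENNReal.ofReal a * ‖v‖ₑ ^ 2 := by
  rw [enorm_smul, mul_pow, enorm_sq_eq_ofReal (√a : ℂ), Complex.norm_real, Real.norm_eq_abs,
    sq_abs, Real.sq_sqrt ha]

theorem exists_isDec_sorted {A : E →L[ℂ] E} (hA : A.IsPositive) (hT : traceENN A ≠ ∞) :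
    ∃ x : ℕ → E, (∀ i j, i ≠ j → (inner ℂ (x i) (x j) : ℂ) = 0) ∧ IsDec A x ∧
      ∀ j : ℕ, ((j : ℝ≥0∞) + 1) * ‖x j‖ₑ ^ 2 ≤ traceENN A := by
  obtain ⟨s, hs, hev⟩ := exists_eigenbasis hA hT
  have hdec : IsDec A (fun v : s => ((√(qf A v) : ℝ) : ℂ) • (v : E)) := by
    intro y
    rw [← tsum_eigenbasis hA hs hev y]
    refine tsum_congr fun v => ?_
    rw [inner_smul_left, Complex.conj_ofReal, ← smul_eq_mul, enorm_sqrt_smul_sq (qf_nonneg hA _)]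
  set p : s → ℝ≥0∞ := fun v => ENNReal.ofReal (qf A v) with hp
  have hpn : ∀ v : s, ‖((√(qf A v) : ℝ) : ℂ) • (v : E)‖ₑ ^ 2 = p v := fun v => by
    rw [enorm_sqrt_smul_sq (qf_nonneg hA _), ← ofReal_norm, hs.1.1 v]; simp [hp]
  have htr : traceENN A = ∑' v, p v := by rw [hdec.traceENN_eq]; exact tsum_congr hpn
  obtain ⟨r, hr, hrs⟩ := exists_injective_rank p (htr ▸ hT)
  set x : ℕ → E := Function.extend r (fun v => ((√(qf A v.1) : ℝ) : ℂ) • (v.1 : E)) 0 with hx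
  have hx1 : ∀ v, x (r v) = ((√(qf A v.1) : ℝ) : ℂ) • (v.1 : E) := fun v => hr.extend_apply _ _ v
  have hx0 : ∀ j, (¬ ∃ v, r v = j) → x j = 0 := fun j hj => Function.extend_apply' _ _ _ hj
  refine ⟨x, ?_, ?_, ?_⟩
  · intro i j hij
    by_cases hi : ∃ v, r v = i
    · by_cases hj : ∃ v, r v = j
      · obtain ⟨v, rfl⟩ := hi
        obtain ⟨w, rfl⟩ := hj
        rw [hx1, hx1, inner_smul_left, inner_smul_right,
          hs.1.2 (fun h => hij (by rw [Subtype.ext h])), mul_zero, mul_zero]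
      · rw [hx0 j hj, inner_zero_right]
    · rw [hx0 i hi, inner_zero_left]
  · intro y
    rw [← hdec y]
    have h1 : ∑' j, ‖(inner ℂ (x j) y : ℂ)‖ₑ ^ 2 = ∑' v, ‖(inner ℂ (x (r v)) y : ℂ)‖ₑ ^ 2 := by
      refine (hr.tsum_eq (f := fun j => ‖(inner ℂ (x j) y : ℂ)‖ₑ ^ 2) fun j hj => ?_).symm
      by_contra h
      simp [hx0 j (fun ⟨v, hv⟩ => h ⟨v, hv⟩)] at hj
    rw [h1]
    simp_rw [hx1]
    refine tsum_subtype_eq_of_support_subset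
      (f := fun v : s => ‖(inner ℂ (((√(qf A v) : ℝ) : ℂ) • (v : E)) y : ℂ)‖ₑ ^ 2) fun v hv => ?_
    intro h
    apply hv
    have : ((√(qf A v) : ℝ) : ℂ) • (v : E) = 0 := by
      simpa [h] using hpn v
    simp [this]
  · intro j
    by_cases hj : ∃ v, r v = j
    · obtain ⟨v, rfl⟩ := hj
      rw [hx1, hpn, htr]
      exact hrs v
    · simp [hx0 j hj]

end Spectral

section EntropyFormula

variable {E : Type*} [NormedAddCommGroup E] [InnerProductSpace ℂ E] [CompleteSpace E]

theorem clEntropy_eq_ent {ι : Type*} (x : ι → ℝ) (hx : ∀ i, 0 ≤ x i)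
    (hfin : ∑' i, ENNReal.ofReal (x i) ≠ ∞) :
    clEntropy x = ent fun i => ENNReal.ofReal (x i) := by
  have hsum : Summable x := by
    simpa [ENNReal.toReal_ofReal (hx _)] using ENNReal.summable_toReal hfin
  have hS : ∑' i, ENNReal.ofReal (x i) = ENNReal.ofReal (∑' i, x i) :=
    (ENNReal.ofReal_tsum_of_nonneg hx hsum).symm
  have hS0 : 0 ≤ ∑' i, x i := tsum_nonneg hx
  rw [clEntropy, ent, hS, ← ENNReal.tsum_mul_left]
  refine tsum_congr fun i => ?_
  rw [entTerm, ENNReal.toReal_ofReal hS0, ENNReal.toReal_ofReal (hx i), ← ENNReal.ofReal_mul hS0]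
  congr 1
  rcases (hx i).eq_or_lt with h0 | h0
  · simp [← h0]
  have hpos : 0 < ∑' i, x i := h0.trans_le (hsum.le_tsum i fun j _ => hx j)
  rw [Real.negMulLog, Real.log_div h0.ne' hpos.ne']
  field_simp
  ring

theorem tsum_qf_eq_traceENN {A : E →L[ℂ] E} (hA : A.IsPositive) (hT : traceENN A ≠ ∞)
    {s : Set E} (hs : IsONB s) : ∑' v : s, ENNReal.ofReal (qf A v) = traceENN A := by
  obtain ⟨x, -, hx, -⟩ := exists_isDec_sorted hA hT
  rw [hx.tsum_qf hs, hx.traceENN_eq]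

theorem clEntropy_qf {A : E →L[ℂ] E} (hA : A.IsPositive) (hT : traceENN A ≠ ∞)
    {s : Set E} (hs : IsONB s) :
    clEntropy (fun v : s => qf A v) = ∑' v : s, entTerm (traceENN A) (ENNReal.ofReal (qf A v)) := by
  rw [clEntropy_eq_ent _ (fun v => qf_nonneg hA _)
    (by rw [tsum_qf_eq_traceENN hA hT hs]; exact hT), ent, tsum_qf_eq_traceENN hA hT hs]

/-- An orthonormal family of vectors cannot decrease the entropy of an orthogonal family. -/
theorem tsum_entTerm_le_of_orthogonal {ι : Type*} {w : ι → E} {S : ℝ≥0∞} (hS : S ≠ ∞)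
    (hw : ∀ i j, i ≠ j → (inner ℂ (w i) (w j) : ℂ) = 0) (hwS : ∀ j, ‖w j‖ₑ ^ 2 ≤ S)
    {s : Set E} (hs : IsONB s) :
    ∑' j, entTerm S (‖w j‖ₑ ^ 2) ≤
      ∑' v : s, entTerm S (∑' j, ‖(inner ℂ (w j) (v : E) : ℂ)‖ₑ ^ 2) := by
  refine tsum_entTerm_le_of_substochastic hS _ _
    (fun (v : s) j => ‖(inner ℂ (w j) (v : E) : ℂ)‖ₑ ^ 2 / ‖w j‖ₑ ^ 2) ?_ ?_ ?_ hwS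
  · intro v
    refine tsum_congr fun j => ?_
    rcases eq_or_ne (w j) 0 with h | h
    · simp [h]
    · rw [ENNReal.div_mul_cancel (by simpa using h) (by simp)]
  · intro v
    refine (tsum_enorm_inner_sq_div_le hw (v : E)).trans ?_
    rw [← ofReal_norm, hs.1.1 v]; simp
  · intro j hj
    simp_rw [div_eq_mul_inv]
    rw [ENNReal.tsum_mul_right]
    simp_rw [enorm_inner_comm (w j)]
    rw [tsum_enorm_inner_sq hs, ENNReal.mul_inv_cancel hj (by simp)]

theorem IsDec.tsum_div_eigenvalue_le {ι : Type*} {A : E →L[ℂ] E} (hA : A.IsPositive) {x : ι → E}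
    (h : IsDec A x) {s : Set E} (hs : IsONB s)
    (hev : ∀ v ∈ s, A v = ((qf A v : ℝ) : ℂ) • v) (j : ι) :
    ∑' v : s, ‖(inner ℂ (x j) (v : E) : ℂ)‖ₑ ^ 2 / ENNReal.ofReal (qf A v) ≤ 1 := by
  have hz : ∀ v : s, qf A v = 0 → (inner ℂ (x j) (v : E) : ℂ) = 0 := fun v hv => by
    have h1 := h (v : E)
    rw [hv, ENNReal.ofReal_zero, ENNReal.tsum_eq_zero] at h1
    simpa using h1 j
  rw [ENNReal.tsum_eq_iSup_sum]
  refine iSup_le fun K => ?_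
  set c : ℝ := ∑ v ∈ K, ‖(inner ℂ (x j) (v : E) : ℂ)‖ ^ 2 / qf A v with hc
  have hc0 : 0 ≤ c := Finset.sum_nonneg fun v _ => div_nonneg (by positivity) (qf_nonneg hA _)
  have hsum : ∑ v ∈ K, ‖(inner ℂ (x j) (v : E) : ℂ)‖ₑ ^ 2 / ENNReal.ofReal (qf A v) =
      ENNReal.ofReal c := by
    rw [hc, ENNReal.ofReal_sum_of_nonneg
      fun v _ => div_nonneg (by positivity) (qf_nonneg hA _)]
    refine Finset.sum_congr rfl fun v _ => ?_
    rcases (qf_nonneg hA (v : E)).eq_or_lt with h0 | h0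
    · simp [hz v h0.symm]
    · rw [enorm_sq_eq_ofReal, ENNReal.ofReal_div_of_pos h0]
  rw [hsum]
  set y : E := ∑ v ∈ K, ((inner ℂ (v : E) (x j) : ℂ) / (qf A v : ℂ)) • (v : E) with hy
  have hin : (inner ℂ (x j) y : ℂ) = (c : ℂ) := by
    rw [hy, inner_sum, hc, Complex.ofReal_sum]
    refine Finset.sum_congr rfl fun v _ => ?_
    rw [inner_smul_right, div_mul_eq_mul_div, ← inner_conj_symm (v : E) (x j),
      Complex.conj_mul']
    push_cast
    rfl
  have hcoord : ∀ v : s, (inner ℂ (v : E) y : ℂ) =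
      if v ∈ K then (inner ℂ (v : E) (x j) : ℂ) / (qf A v : ℂ) else 0 := by
    intro v
    split_ifs with hv
    · exact hs.1.inner_right_sum _ hv
    · rw [hy, inner_sum]
      refine Finset.sum_eq_zero fun u hu => ?_
      rw [inner_smul_right, hs.1.2 (fun h : v = u => hv (h ▸ hu)), mul_zero]
  have hq : ENNReal.ofReal (qf A y) = ENNReal.ofReal c := by
    rw [← tsum_eigenbasis hA hs hev y, ← hsum, tsum_eq_sum (s := K)
      (fun v hv => by simp [hcoord, hv])]
    refine Finset.sum_congr rfl fun v hv => ?_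
    rw [hcoord, if_pos hv]
    rcases (qf_nonneg hA (v : E)).eq_or_lt with h0 | h0
    · simp [← h0, hz v h0.symm]
    · rw [enorm_sq_eq_ofReal, enorm_sq_eq_ofReal, ← ENNReal.ofReal_mul h0.le,
        ← ENNReal.ofReal_div_of_pos h0]
      congr 1
      rw [norm_div, Complex.norm_real, Real.norm_of_nonneg h0.le, norm_inner_symm (x j)]
      field_simp
  have hle : ‖(inner ℂ (x j) y : ℂ)‖ₑ ^ 2 ≤ ENNReal.ofReal c := by
    rw [← hq, ← h y]
    exact ENNReal.le_tsum (f := fun j => ‖(inner ℂ (x j) y : ℂ)‖ₑ ^ 2) j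
  rw [hin, enorm_sq_eq_ofReal, Complex.norm_real, Real.norm_of_nonneg hc0,
    ENNReal.ofReal_le_ofReal_iff hc0] at hle
  rw [← ENNReal.ofReal_one]
  refine ENNReal.ofReal_le_ofReal ?_
  by_contra hlt
  nlinarith

/-- The entropy of an operator is bounded by the entropy of any of its decompositions into
operators of rank one. -/
theorem IsDec.qEntropy_le {ι : Type*} {A : E →L[ℂ] E} (hA : A.IsPositive)
    {x : ι → E} (h : IsDec A x) (hT : ∑' j, ‖x j‖ₑ ^ 2 ≠ ∞) :
    qEntropy A ≤ ent fun j => ‖x j‖ₑ ^ 2 := by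
  have hT' : traceENN A ≠ ∞ := by rwa [h.traceENN_eq]
  obtain ⟨s, hs, hev⟩ := exists_eigenbasis hA hT'
  refine (iInf₂_le s hs).trans ?_
  rw [clEntropy_qf hA hT' hs, ent, ← h.traceENN_eq]
  have hz : ∀ v : s, ∀ j, qf A v = 0 → (inner ℂ (x j) (v : E) : ℂ) = 0 := fun v j hv => by
    have h1 := h (v : E)
    rw [hv, ENNReal.ofReal_zero, ENNReal.tsum_eq_zero] at h1
    simpa using h1 j
  refine tsum_entTerm_le_of_substochastic hT' _ _
    (fun j (v : s) => ‖(inner ℂ (x j) (v : E) : ℂ)‖ₑ ^ 2 / ENNReal.ofReal (qf A v))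
    ?_ ?_ ?_ ?_
  · intro j
    rw [← tsum_enorm_inner_sq hs]
    refine tsum_congr fun v => ?_
    rw [enorm_inner_comm]
    rcases (qf_nonneg hA (v : E)).eq_or_lt with h0 | h0
    · simp [hz v j h0.symm]
    · rw [ENNReal.div_mul_cancel (by simpa using h0) (by simp)]
  · exact h.tsum_div_eigenvalue_le hA hs hev
  · intro v hv
    simp_rw [div_eq_mul_inv]
    rw [ENNReal.tsum_mul_right, h, ENNReal.mul_inv_cancel hv (by simp)]
  · intro v
    rw [← tsum_qf_eq_traceENN hA hT' hs]
    exact ENNReal.le_tsum (f := fun v : s => ENNReal.ofReal (qf A v)) v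

theorem IsDec.qEntropy_eq {ι : Type*} {A : E →L[ℂ] E} (hA : A.IsPositive)
    {w : ι → E} (h : IsDec A w) (hT : ∑' j, ‖w j‖ₑ ^ 2 ≠ ∞)
    (hw : ∀ i j, i ≠ j → (inner ℂ (w i) (w j) : ℂ) = 0) :
    qEntropy A = ent fun j => ‖w j‖ₑ ^ 2 := by
  have hT' : traceENN A ≠ ∞ := by rwa [h.traceENN_eq]
  refine le_antisymm (h.qEntropy_le hA hT) (le_iInf₂ fun s hs => ?_)
  rw [clEntropy_qf hA hT' hs, ent, h.traceENN_eq]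
  refine (tsum_entTerm_le_of_orthogonal hT hw (fun j => ENNReal.le_tsum (f := fun j => ‖w j‖ₑ ^ 2) j)
    hs).trans (le_of_eq (tsum_congr fun v => ?_))
  rw [h]

end EntropyFormula

section Compactness

variable {E : Type*} [NormedAddCommGroup E] [InnerProductSpace ℂ E] [CompleteSpace E]

theorem exists_tendsto_of_forall_eventually_dist_lt {α X : Type*} [MetricSpace X] [CompleteSpace X]
    (U : Ultrafilter α) (f : α → X) (h : ∀ ε : ℝ, 0 < ε → ∃ z, ∀ᶠ a in U, dist (f a) z < ε) :
    ∃ x, Tendsto f U (𝓝 x) := by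
  rw [← cauchy_map_iff_exists_tendsto, Metric.cauchy_iff]
  refine ⟨inferInstance, fun ε hε => ?_⟩
  obtain ⟨z, hz⟩ := h (ε / 2) (half_pos hε)
  refine ⟨{y | dist y z < ε / 2}, hz, fun x hx y hy => ?_⟩
  calc dist x y ≤ dist x z + dist y z := dist_triangle_right x y z
    _ < ε / 2 + ε / 2 := add_lt_add hx hy
    _ = ε := add_halves ε

theorem exists_tendsto_of_eventually_norm_le {α : Type*} (U : Ultrafilter α) (f : α → ℂ) (C : ℝ)
    (h : ∀ᶠ a in U, ‖f a‖ ≤ C) : ∃ c, Tendsto f U (𝓝 c) := by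
  obtain ⟨c, -, hc⟩ := (isCompact_closedBall (0 : ℂ) C).ultrafilter_le_nhds (U.map f) (by
    rw [le_principal_iff, Ultrafilter.mem_coe, Ultrafilter.mem_map]
    filter_upwards [h] with a ha
    simpa using ha)
  exact ⟨c, hc⟩

theorem enorm_sub_sum_sq {s : Set E} (hs : IsONB s) (K : Finset s) (x : E) :
    ‖x - ∑ v ∈ K, (inner ℂ (v : E) x : ℂ) • (v : E)‖ₑ ^ 2 =
      ∑' v : {v // v ∉ K}, ‖(inner ℂ (v : E) x : ℂ)‖ₑ ^ 2 := by
  set z : E := ∑ v ∈ K, (inner ℂ (v : E) x : ℂ) • (v : E) with hz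
  have hcoord : ∀ v : s, (inner ℂ (v : E) z : ℂ) =
      if v ∈ K then (inner ℂ (v : E) x : ℂ) else 0 := by
    intro v
    split_ifs with hv
    · exact hs.1.inner_right_sum (fun v : s => (inner ℂ (v : E) x : ℂ)) hv
    · rw [hz, inner_sum]
      refine Finset.sum_eq_zero fun u hu => ?_
      rw [inner_smul_right, hs.1.2 (fun h : v = u => hv (h ▸ hu)), mul_zero]
  rw [← tsum_enorm_inner_sq hs, ← ENNReal.sum_add_tsum_compl K, Finset.sum_eq_zero, zero_add]
  · refine tsum_congr fun v => ?_
    have hv : (v : s) ∉ K := v.2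
    rw [inner_sub_right, hcoord, if_neg hv, sub_zero]
  · intro v hv
    rw [inner_sub_right, hcoord, if_pos hv, sub_self]; simp

variable {α : Type*} (U : Ultrafilter α) {B : α → E →L[ℂ] E} {B₀ : E →L[ℂ] E}

/-- Vectors dominated by a convergent family of positive trace-class operators form a relatively
compact family. -/
theorem exists_tendsto_of_rankOne_le (hB : ∀ a, (B a).IsPositive) (hB₀ : B₀.IsPositive)
    (hT : ∀ a, traceENN (B a) ≠ ∞) (hT₀ : traceENN B₀ ≠ ∞)
    (hq : ∀ y, Tendsto (fun a => qf (B a) y) U (𝓝 (qf B₀ y)))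
    (htr : Tendsto (fun a => traceENN (B a)) U (𝓝 (traceENN B₀))) (x : α → E)
    (hx : ∀ a y, ‖(inner ℂ (x a) y : ℂ)‖ₑ ^ 2 ≤ ENNReal.ofReal (qf (B a) y)) :
    ∃ x₀, Tendsto x U (𝓝 x₀) := by
  obtain ⟨s, hs⟩ := exists_isONB E
  have hcoord : ∀ v : s, ∃ c, Tendsto (fun a => (inner ℂ (v : E) (x a) : ℂ)) U (𝓝 c) := by
    intro v
    refine exists_tendsto_of_eventually_norm_le U _ (√(qf B₀ v + 1)) ?_
    have h1 : ∀ᶠ a in U, qf (B a) v < qf B₀ v + 1 :=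
      (hq v).eventually (gt_mem_nhds (lt_add_one _))
    filter_upwards [h1] with a ha
    have h2 := hx a v
    rw [enorm_sq_eq_ofReal, ENNReal.ofReal_le_ofReal_iff (qf_nonneg (hB a) _),
      norm_inner_symm] at h2
    exact Real.le_sqrt_of_sq_le (h2.trans ha.le)
  choose c hc using hcoord
  refine exists_tendsto_of_forall_eventually_dist_lt U x fun ε hε => ?_
  have hsum₀ := tsum_qf_eq_traceENN hB₀ hT₀ hs
  have htail := ENNReal.tendsto_tsum_compl_atTop_zero (f := fun v : s => ENNReal.ofReal (qf B₀ v))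
    (by rw [hsum₀]; exact hT₀)
  have hε2 : 0 < ENNReal.ofReal ((ε / 2) ^ 2) := ENNReal.ofReal_pos.2 (by positivity)
  obtain ⟨K, hK⟩ := (htail.eventually (gt_mem_nhds hε2)).exists
  have hsub : ∀ C : E →L[ℂ] E, C.IsPositive → traceENN C ≠ ∞ →
      ∑' v : {v // v ∉ K}, ENNReal.ofReal (qf C v) =
        traceENN C - ∑ v ∈ K, ENNReal.ofReal (qf C v) := by
    intro C hC hCT
    rw [← tsum_qf_eq_traceENN hC hCT hs, ← ENNReal.sum_add_tsum_compl K,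
      ENNReal.add_sub_cancel_left (ENNReal.sum_ne_top.2 fun i _ => ENNReal.ofReal_ne_top)]
    rfl
  have htend : Tendsto (fun a => ∑' v : {v // v ∉ K}, ENNReal.ofReal (qf (B a) v)) U
      (𝓝 (∑' v : {v // v ∉ K}, ENNReal.ofReal (qf B₀ v))) := by
    rw [hsub B₀ hB₀ hT₀]
    simp_rw [hsub _ (hB _) (hT _)]
    exact ENNReal.Tendsto.sub htr
      (tendsto_finsetSum _ fun v _ => ENNReal.tendsto_ofReal (hq v)) (Or.inl hT₀)
  refine ⟨∑ v ∈ K, c v • (v : E), ?_⟩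
  have hP : Tendsto (fun a => ∑ v ∈ K, (inner ℂ (v : E) (x a) : ℂ) • (v : E)) U
      (𝓝 (∑ v ∈ K, c v • (v : E))) :=
    tendsto_finsetSum _ fun v _ => (hc v).smul_const _
  filter_upwards [htend.eventually (gt_mem_nhds hK),
    Metric.tendsto_nhds.1 hP (ε / 2) (half_pos hε)] with a ha1 ha2
  have h1 : dist (x a) (∑ v ∈ K, (inner ℂ (v : E) (x a) : ℂ) • (v : E)) < ε / 2 := by
    rw [dist_eq_norm]
    have h2 := (enorm_sub_sum_sq hs K (x a)).le.trans_lt ((ENNReal.tsum_le_tsum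
      fun v => (by rw [enorm_inner_comm]; exact hx a v)).trans_lt ha1)
    rw [enorm_sq_eq_ofReal, ENNReal.ofReal_lt_ofReal_iff (by positivity)] at h2
    exact (sq_lt_sq₀ (norm_nonneg _) (half_pos hε).le).1 h2
  calc dist (x a) _ ≤ _ := dist_triangle _ _ _
    _ < ε / 2 + ε / 2 := add_lt_add h1 ha2
    _ = ε := add_halves ε

/-- Eigenvectors of a convergent family of positive trace-class operators converge along every
ultrafilter. -/
theorem exists_tendsto_isDec (hB : ∀ a, (B a).IsPositive) (hB₀ : B₀.IsPositive)
    (hT : ∀ a, traceENN (B a) ≠ ∞) (hT₀ : traceENN B₀ ≠ ∞)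
    (hq : ∀ y, Tendsto (fun a => qf (B a) y) U (𝓝 (qf B₀ y)))
    (htr : Tendsto (fun a => traceENN (B a)) U (𝓝 (traceENN B₀))) :
    ∃ (x : α → ℕ → E) (x₀ : ℕ → E), (∀ a, IsDec (B a) (x a)) ∧ IsDec B₀ x₀ ∧
      (∀ j, Tendsto (fun a => x a j) U (𝓝 (x₀ j))) ∧
      ∀ a, qEntropy (B a) = ent fun j => ‖x a j‖ₑ ^ 2 := by
  choose x hxo hx hxs using fun a => exists_isDec_sorted (hB a) (hT a)
  choose x₀ hx₀ using fun j => exists_tendsto_of_rankOne_le U hB hB₀ hT hT₀ hq htr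
    (fun a => x a j) (fun a y => by
      rw [← hx a y]
      exact ENNReal.le_tsum (f := fun j => ‖(inner ℂ (x a j) y : ℂ)‖ₑ ^ 2) j)
  refine ⟨x, x₀, hx, ?_, hx₀,
    fun a => (hx a).qEntropy_eq (hB a) (by rw [← (hx a).traceENN_eq]; exact hT a) (hxo a)⟩
  intro y
  have hco : ∀ j, Tendsto (fun a => ‖(inner ℂ (x a j) y : ℂ)‖ₑ ^ 2) U
      (𝓝 (‖(inner ℂ (x₀ j) y : ℂ)‖ₑ ^ 2)) := fun j =>
    ((ENNReal.continuous_pow 2).tendsto _).comp ((hx₀ j).inner tendsto_const_nhds).enorm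
  have hqy : Tendsto (fun a => ENNReal.ofReal (qf (B a) y)) U (𝓝 (ENNReal.ofReal (qf B₀ y))) :=
    ENNReal.tendsto_ofReal (hq y)
  apply le_antisymm
  · exact tsum_le_of_tendsto (l := (U : Filter α))
      (f := fun a j => ‖(inner ℂ (x a j) y : ℂ)‖ₑ ^ 2) hco (by simpa only [hx _ y] using hqy)
  · have htail : ∀ a (m : ℕ), ENNReal.ofReal (qf (B a) y) ≤
        ∑ j ∈ Finset.range m, ‖(inner ℂ (x a j) y : ℂ)‖ₑ ^ 2 +
          traceENN (B a) * ((m : ℝ≥0∞) + 1)⁻¹ * ‖y‖ₑ ^ 2 := by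
      intro a m
      rw [← hx a y, ← Summable.sum_add_tsum_nat_add' (k := m) ENNReal.summable]
      gcongr
      refine tsum_enorm_inner_sq_le_mul (fun i j hij => hxo a _ _ (by omega)) (fun j => ?_) y
      rw [← div_eq_mul_inv, ENNReal.le_div_iff_mul_le (by simp) (by simp), mul_comm]
      refine le_trans ?_ (hxs a (j + m))
      gcongr
      exact le_add_self
    have hlim : ∀ m : ℕ, ENNReal.ofReal (qf B₀ y) ≤ ∑' j, ‖(inner ℂ (x₀ j) y : ℂ)‖ₑ ^ 2 +
          traceENN B₀ * ((m : ℝ≥0∞) + 1)⁻¹ * ‖y‖ₑ ^ 2 := by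
      intro m
      have h1 : Tendsto (fun a => ∑ j ∈ Finset.range m, ‖(inner ℂ (x a j) y : ℂ)‖ₑ ^ 2 +
          traceENN (B a) * ((m : ℝ≥0∞) + 1)⁻¹ * ‖y‖ₑ ^ 2) U
          (𝓝 (∑ j ∈ Finset.range m, ‖(inner ℂ (x₀ j) y : ℂ)‖ₑ ^ 2 +
          traceENN B₀ * ((m : ℝ≥0∞) + 1)⁻¹ * ‖y‖ₑ ^ 2)) := by
        refine (tendsto_finsetSum _ fun j _ => hco j).add ?_
        refine ENNReal.Tendsto.mul_const (ENNReal.Tendsto.mul_const htr (Or.inr ?_)) (Or.inr ?_)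
        · simp
        · simp
      refine (le_of_tendsto_of_tendsto' hqy h1 fun a => htail a m).trans ?_
      gcongr
      exact ENNReal.sum_le_tsum _
    have h2 : Tendsto (fun m : ℕ => ∑' j, ‖(inner ℂ (x₀ j) y : ℂ)‖ₑ ^ 2 +
          traceENN B₀ * ((m : ℝ≥0∞) + 1)⁻¹ * ‖y‖ₑ ^ 2) atTop
          (𝓝 (∑' j, ‖(inner ℂ (x₀ j) y : ℂ)‖ₑ ^ 2 + traceENN B₀ * 0 * ‖y‖ₑ ^ 2)) := by
      refine tendsto_const_nhds.add ?_
      refine ENNReal.Tendsto.mul_const (ENNReal.Tendsto.const_mul ?_ (Or.inr hT₀)) (Or.inr ?_)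
      · have := (tendsto_add_atTop_iff_nat 1).2 ENNReal.tendsto_inv_nat_nhds_zero
        simpa using this
      · simp
    simpa using ge_of_tendsto' h2 hlim

theorem tendsto_enorm_sq {x : α → E} {x₀ : E} (hx : Tendsto x U (𝓝 x₀)) :
    Tendsto (fun a => ‖x a‖ₑ ^ 2) U (𝓝 (‖x₀‖ₑ ^ 2)) :=
  ((ENNReal.continuous_pow 2).tendsto _).comp hx.enorm

/-- The entropy of an orthogonal family is lower semicontinuous. -/
theorem ent_le_of_tendsto {ι : Type*} {p : α → ι → ℝ≥0∞} {p₀ : ι → ℝ≥0∞} {L : ℝ≥0∞}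
    (hp : ∀ j, Tendsto (fun a => p a j) U (𝓝 (p₀ j)))
    (hs : Tendsto (fun a => ∑' j, p a j) U (𝓝 (∑' j, p₀ j))) (hfin : ∑' j, p₀ j ≠ ∞)
    (hL : Tendsto (fun a => ent (p a)) U (𝓝 L)) : ent p₀ ≤ L :=
  tsum_le_of_tendsto (l := (U : Filter α))
    (f := fun a j => entTerm (∑' i, p a i) (p a j)) (fun j => tendsto_entTerm hs (hp j) (fun _ => ENNReal.le_tsum j)
    (ENNReal.le_tsum j) hfin) hL

/-- Lower semicontinuity of the quantum entropy. -/
theorem qEntropy_le_of_tendsto (hB : ∀ a, (B a).IsPositive) (hB₀ : B₀.IsPositive)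
    (hT : ∀ a, traceENN (B a) ≠ ∞) (hT₀ : traceENN B₀ ≠ ∞)
    (hq : ∀ y, Tendsto (fun a => qf (B a) y) U (𝓝 (qf B₀ y)))
    (htr : Tendsto (fun a => traceENN (B a)) U (𝓝 (traceENN B₀))) {L : ℝ≥0∞}
    (hL : Tendsto (fun a => qEntropy (B a)) U (𝓝 L)) : qEntropy B₀ ≤ L := by
  obtain ⟨x, x₀, hx, hx₀, hlim, hent⟩ := exists_tendsto_isDec U hB hB₀ hT hT₀ hq htr
  have hfin : ∑' j, ‖x₀ j‖ₑ ^ 2 ≠ ∞ := by rwa [← hx₀.traceENN_eq]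
  refine (hx₀.qEntropy_le hB₀ hfin).trans ?_
  refine ent_le_of_tendsto U (fun j => tendsto_enorm_sq U (hlim j)) ?_ hfin
    (by simpa only [hent] using hL)
  simpa only [← hx₀.traceENN_eq, ← (hx _).traceENN_eq] using htr

theorem exists_tendsto_isDec_ent (hB : ∀ a, (B a).IsPositive) (hB₀ : B₀.IsPositive)
    (hT : ∀ a, traceENN (B a) ≠ ∞) (hT₀ : traceENN B₀ ≠ ∞)
    (hq : ∀ y, Tendsto (fun a => qf (B a) y) U (𝓝 (qf B₀ y)))
    (htr : Tendsto (fun a => traceENN (B a)) U (𝓝 (traceENN B₀)))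
    (hL : Tendsto (fun a => qEntropy (B a)) U (𝓝 (qEntropy B₀))) :
    ∃ (x : α → ℕ → E) (x₀ : ℕ → E), (∀ a, IsDec (B a) (x a)) ∧ IsDec B₀ x₀ ∧
      (∀ j, Tendsto (fun a => x a j) U (𝓝 (x₀ j))) ∧
      (∀ a, qEntropy (B a) = ent fun j => ‖x a j‖ₑ ^ 2) ∧
      qEntropy B₀ = ent fun j => ‖x₀ j‖ₑ ^ 2 := by
  obtain ⟨x, x₀, hx, hx₀, hlim, hent⟩ := exists_tendsto_isDec U hB hB₀ hT hT₀ hq htr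
  have hfin : ∑' j, ‖x₀ j‖ₑ ^ 2 ≠ ∞ := by rwa [← hx₀.traceENN_eq]
  refine ⟨x, x₀, hx, hx₀, hlim, hent, le_antisymm (hx₀.qEntropy_le hB₀ hfin) ?_⟩
  refine ent_le_of_tendsto U (fun j => tendsto_enorm_sq U (hlim j)) ?_ hfin
    (by simpa only [hent] using hL)
  simpa only [← hx₀.traceENN_eq, ← (hx _).traceENN_eq] using htr

end Compactness

section Continuity

variable {E : Type*} [NormedAddCommGroup E] [InnerProductSpace ℂ E] [CompleteSpace E]

theorem tsum_sum_type {ι κ : Type*} (f : ι ⊕ κ → ℝ≥0∞) :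
    ∑' i, f i = ∑' i, f (Sum.inl i) + ∑' k, f (Sum.inr k) :=
  (HasSum.sum (f := f) ENNReal.summable.hasSum ENNReal.summable.hasSum).tsum_eq

/-- A unitary matrix which makes a given finite family of vectors orthogonal. -/
theorem exists_orthonormalBasis_orthogonalizing {κ : Type*} [Fintype κ] (z : κ → E) :
    ∃ (n : ℕ) (u : OrthonormalBasis (Fin n) ℂ (EuclideanSpace ℂ κ)), ∀ i k, i ≠ k →
      (inner ℂ (∑ j, u i j • z j) (∑ j, u k j • z j) : ℂ) = 0 := by
  set J : EuclideanSpace ℂ κ →L[ℂ] E :=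
    ∑ j, (EuclideanSpace.proj j : EuclideanSpace ℂ κ →L[ℂ] ℂ).smulRight (z j) with hJ
  have hJa : ∀ c, J c = ∑ j, c j • z j := fun c => by simp [hJ]
  have hT : ((ContinuousLinearMap.adjoint J ∘L J :
      EuclideanSpace ℂ κ →L[ℂ] EuclideanSpace ℂ κ) : EuclideanSpace ℂ κ →ₗ[ℂ] _).IsSymmetric := by
    intro c d
    simp [ContinuousLinearMap.adjoint_inner_left, ContinuousLinearMap.adjoint_inner_right]
  refine ⟨_, hT.eigenvectorBasis rfl, fun i k hik => ?_⟩
  rw [← hJa, ← hJa, ← ContinuousLinearMap.adjoint_inner_right]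
  have := hT.apply_eigenvectorBasis rfl k
  rw [ContinuousLinearMap.coe_coe, ContinuousLinearMap.comp_apply] at this
  rw [this, inner_smul_right, (hT.eigenvectorBasis rfl).orthonormal.2 hik, mul_zero]

theorem sum_enorm_inner_sq_unitary {κ ι : Type*} [Fintype κ] [Fintype ι]
    (u : OrthonormalBasis ι ℂ (EuclideanSpace ℂ κ)) (z : κ → E) (y : E) :
    ∑ i, ‖(inner ℂ (∑ j, u i j • z j) y : ℂ)‖ₑ ^ 2 = ∑ j, ‖(inner ℂ (z j) y : ℂ)‖ₑ ^ 2 := by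
  set c : EuclideanSpace ℂ κ := WithLp.toLp 2 fun j => (inner ℂ (z j) y : ℂ) with hc
  have h1 : ∀ i, (inner ℂ (∑ j, u i j • z j) y : ℂ) = inner ℂ (u i) c := fun i => by
    rw [sum_inner, PiLp.inner_apply]
    refine Finset.sum_congr rfl fun j _ => ?_
    rw [inner_smul_left]
    simp [hc, mul_comm]
  have h2 := u.sum_sq_norm_inner_right c
  have h3 := EuclideanSpace.norm_sq_eq c
  simp_rw [h1, enorm_sq_eq_ofReal]
  rw [← ENNReal.ofReal_sum_of_nonneg (fun _ _ => by positivity),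
    ← ENNReal.ofReal_sum_of_nonneg (fun _ _ => by positivity), h2, h3]

variable {α : Type*} (U : Ultrafilter α) {D : α → E →L[ℂ] E} {D₀ : E →L[ℂ] E}
  {ι : Type*} {z : α → ι → E} {z₀ : ι → E}

theorem tendsto_qf_of_isDec (hD : ∀ a, (D a).IsPositive) (hD₀ : D₀.IsPositive)
    (hz : ∀ a, IsDec (D a) (z a)) (hz₀ : IsDec D₀ z₀)
    (hlim : ∀ j, Tendsto (fun a => z a j) U (𝓝 (z₀ j)))
    (hsum : Tendsto (fun a => ∑' j, ‖z a j‖ₑ ^ 2) U (𝓝 (∑' j, ‖z₀ j‖ₑ ^ 2)))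
    (hfin : ∑' j, ‖z₀ j‖ₑ ^ 2 ≠ ∞) (y : E) :
    Tendsto (fun a => qf (D a) y) U (𝓝 (qf D₀ y)) := by
  have h : Tendsto (fun a => ∑' j, ‖(inner ℂ (z a j) y : ℂ)‖ₑ ^ 2) U
      (𝓝 (∑' j, ‖(inner ℂ (z₀ j) y : ℂ)‖ₑ ^ 2)) := by
    refine tendsto_tsum_of_dominated_tendsto (g := fun a j => ‖z a j‖ₑ ^ 2 * ‖y‖ₑ ^ 2)
      (g₀ := fun j => ‖z₀ j‖ₑ ^ 2 * ‖y‖ₑ ^ 2)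
      (fun j => ((ENNReal.continuous_pow 2).tendsto _).comp
        ((hlim j).inner tendsto_const_nhds).enorm)
      (fun j => ENNReal.Tendsto.mul_const (tendsto_enorm_sq U (hlim j)) (Or.inr (by simp)))
      (Eventually.of_forall fun a j => enorm_inner_sq_le _ _) ?_ ?_
    · simp_rw [ENNReal.tsum_mul_right]
      exact ENNReal.Tendsto.mul_const hsum (Or.inr (by simp))
    · rw [ENNReal.tsum_mul_right]
      exact ENNReal.mul_ne_top hfin (by simp)
  simp_rw [hz _ y, hz₀ y] at h
  have h2 := (ENNReal.tendsto_toReal ENNReal.ofReal_ne_top).comp h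
  rw [ENNReal.toReal_ofReal (qf_nonneg hD₀ y)] at h2
  exact h2.congr fun a => ENNReal.toReal_ofReal (qf_nonneg (hD a) y)

/-- Replacing finitely many vectors of a decomposition by their unitary combinations. -/
theorem IsDec.sumElim {A : E →L[ℂ] E} {x : ι → E} (h : IsDec A x) (K : Finset ι) {n : ℕ}
    (u : OrthonormalBasis (Fin n) ℂ (EuclideanSpace ℂ K)) :
    IsDec A (Sum.elim (fun i : Fin n => ∑ j : K, u i j • x j) (fun j : {j // j ∉ K} => x j)) := by
  intro y
  rw [tsum_sum_type, tsum_fintype, ← h y, ← ENNReal.sum_add_tsum_compl K]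
  simp only [Sum.elim_inl, Sum.elim_inr]
  rw [sum_enorm_inner_sq_unitary u (fun j : K => x j) y,
    Finset.sum_coe_sort K (fun j => ‖(inner ℂ (x j) y : ℂ)‖ₑ ^ 2)]
  rfl

theorem qEntropy_limit_le (hD : ∀ a, (D a).IsPositive)
    (hz : ∀ a, IsDec (D a) (z a)) (hz₀ : IsDec D₀ z₀)
    (hlim : ∀ j, Tendsto (fun a => z a j) U (𝓝 (z₀ j)))
    (hsum : Tendsto (fun a => ∑' j, ‖z a j‖ₑ ^ 2) U (𝓝 (∑' j, ‖z₀ j‖ₑ ^ 2)))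
    (hfina : ∀ a, ∑' j, ‖z a j‖ₑ ^ 2 ≠ ∞) (hfin : ∑' j, ‖z₀ j‖ₑ ^ 2 ≠ ∞)
    (hent : Tendsto (fun a => ent fun j => ‖z a j‖ₑ ^ 2) U (𝓝 (ent fun j => ‖z₀ j‖ₑ ^ 2)))
    (hentfin : (ent fun j => ‖z₀ j‖ₑ ^ 2) ≠ ∞) {L : ℝ≥0∞}
    (hL : Tendsto (fun a => qEntropy (D a)) U (𝓝 L)) (K : Finset ι) {s : Set E} (hs : IsONB s) :
    L ≤ ∑' v : s, entTerm (traceENN D₀) (ENNReal.ofReal (qf D₀ v)) +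
      (∑' j : {j // j ∉ K}, ‖z₀ j‖ₑ ^ 2 +
        ∑' j : {j // j ∉ K}, entTerm (traceENN D₀) (‖z₀ j‖ₑ ^ 2)) := by
  obtain ⟨n, u, hu⟩ := exists_orthonormalBasis_orthogonalizing fun j : K => z₀ j
  set w : (ι → E) → Fin n → E := fun x i => ∑ j : K, u i j • x j with hw
  have hwlim : ∀ i, Tendsto (fun a => w (z a) i) U (𝓝 (w z₀ i)) := fun i =>
    tendsto_finsetSum _ fun j _ => (hlim j).const_smul _
  have hwle : ∀ (A : E →L[ℂ] E) (x : ι → E), IsDec A x → ∀ i, ‖w x i‖ₑ ^ 2 ≤ traceENN A := by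
    intro A x hx i
    rw [(hx.sumElim K u).traceENN_eq]
    exact ENNReal.le_tsum (f := fun j => ‖Sum.elim (fun i : Fin n => ∑ j : K, u i j • x j)
      (fun j : {j // j ∉ K} => x j) j‖ₑ ^ 2) (Sum.inl i)
  have hxle : ∀ (A : E →L[ℂ] E) (x : ι → E), IsDec A x → ∀ i, ‖x i‖ₑ ^ 2 ≤ traceENN A := by
    intro A x hx i
    rw [hx.traceENN_eq]
    exact ENNReal.le_tsum (f := fun j => ‖x j‖ₑ ^ 2) i
  have hT₀ : traceENN D₀ ≠ ∞ := by rwa [hz₀.traceENN_eq]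
  have htr : Tendsto (fun a => traceENN (D a)) U (𝓝 (traceENN D₀)) := by
    simpa only [hz₀.traceENN_eq, (hz _).traceENN_eq] using hsum
  have hup : ∀ a, qEntropy (D a) ≤ ∑ i, entTerm (traceENN (D a)) (‖w (z a) i‖ₑ ^ 2) +
      ∑' j : {j // j ∉ K}, entTerm (traceENN (D a)) (‖z a j‖ₑ ^ 2) := by
    intro a
    have h1 := (hz a).sumElim K u
    have h2 := h1.qEntropy_le (hD a) (by
      rw [← h1.traceENN_eq, (hz a).traceENN_eq]; exact hfina a)
    rw [ent, ← h1.traceENN_eq, tsum_sum_type, tsum_fintype] at h2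
    exact h2
  have hsplit : ∀ (A : E →L[ℂ] E) (x : ι → E), IsDec A x →
      ent (fun j => ‖x j‖ₑ ^ 2) = ∑ j ∈ K, entTerm (traceENN A) (‖x j‖ₑ ^ 2) +
        ∑' j : {j // j ∉ K}, entTerm (traceENN A) (‖x j‖ₑ ^ 2) := by
    intro A x hx
    rw [ent, ← hx.traceENN_eq, ← ENNReal.sum_add_tsum_compl K]
    rfl
  have htail : Tendsto (fun a => ∑' j : {j // j ∉ K}, entTerm (traceENN (D a)) (‖z a j‖ₑ ^ 2)) U
      (𝓝 (∑' j : {j // j ∉ K}, entTerm (traceENN D₀) (‖z₀ j‖ₑ ^ 2))) := by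
    have hne : ∀ (S : ℝ≥0∞) (x : ι → E), ∑ j ∈ K, entTerm S (‖x j‖ₑ ^ 2) ≠ ∞ := fun S x =>
      ENNReal.sum_ne_top.2 fun j _ => ENNReal.ofReal_ne_top
    have hsub : ∀ (A : E →L[ℂ] E) (x : ι → E), IsDec A x →
        ∑' j : {j // j ∉ K}, entTerm (traceENN A) (‖x j‖ₑ ^ 2) =
          ent (fun j => ‖x j‖ₑ ^ 2) - ∑ j ∈ K, entTerm (traceENN A) (‖x j‖ₑ ^ 2) := by
      intro A x hx
      rw [hsplit A x hx, ENNReal.add_sub_cancel_left (hne _ _)]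
    rw [hsub _ _ hz₀]
    simp_rw [hsub _ _ (hz _)]
    exact ENNReal.Tendsto.sub hent (tendsto_finsetSum _ fun j _ =>
      tendsto_entTerm htr (tendsto_enorm_sq U (hlim j)) (fun a => hxle _ _ (hz a) j)
        (hxle _ _ hz₀ j) hT₀) (Or.inl hentfin)
  have hhead : Tendsto (fun a => ∑ i, entTerm (traceENN (D a)) (‖w (z a) i‖ₑ ^ 2)) U
      (𝓝 (∑ i, entTerm (traceENN D₀) (‖w z₀ i‖ₑ ^ 2))) :=
    tendsto_finsetSum _ fun i _ =>
      tendsto_entTerm htr (tendsto_enorm_sq U (hwlim i)) (fun a => hwle _ _ (hz a) i)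
        (hwle _ _ hz₀ i) hT₀
  refine (le_of_tendsto_of_tendsto' hL (hhead.add htail) hup).trans ?_
  rw [← add_assoc]
  gcongr
  have h3 := tsum_entTerm_le_of_orthogonal hT₀ (w := w z₀) hu (hwle _ _ hz₀) hs
  rw [tsum_fintype] at h3
  refine h3.trans ?_
  have hd : ∀ y, ENNReal.ofReal (qf D₀ y) = ∑' i, ‖(inner ℂ (w z₀ i) y : ℂ)‖ₑ ^ 2 +
      ∑' j : {j // j ∉ K}, ‖(inner ℂ (z₀ j) y : ℂ)‖ₑ ^ 2 := by
    intro y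
    rw [← (hz₀.sumElim K u) y, tsum_sum_type]
    rfl
  have htailsum : ∑' j : {j // j ∉ K}, ‖z₀ j‖ₑ ^ 2 =
      ∑' v : s, ∑' j : {j // j ∉ K}, ‖(inner ℂ (z₀ j) (v : E) : ℂ)‖ₑ ^ 2 := by
    rw [ENNReal.tsum_comm]
    refine tsum_congr fun j => ?_
    simp_rw [enorm_inner_comm (z₀ j)]
    rw [tsum_enorm_inner_sq hs]
  rw [htailsum, ← ENNReal.tsum_add]
  refine ENNReal.tsum_le_tsum fun v => ?_
  have hqT : ENNReal.ofReal (qf D₀ v) ≤ traceENN D₀ := by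
    have := sum_qf_le_traceENN D₀ (hs.1.comp (fun _ : Unit => v) (fun _ _ _ => rfl))
    simpa using this
  have hle : ∑' i, ‖(inner ℂ (w z₀ i) (v : E) : ℂ)‖ₑ ^ 2 ≤ ENNReal.ofReal (qf D₀ v) := by
    rw [hd]; exact le_self_add
  refine (entTerm_le_add_sub hle hqT le_rfl (hle.trans hqT) hT₀).trans ?_
  gcongr
  rw [tsub_le_iff_left]
  exact (hd v).le

/-- Continuity of the quantum entropy along convergent decompositions with convergent
entropies. -/
theorem tendsto_qEntropy_of_isDec (hD : ∀ a, (D a).IsPositive) (hD₀ : D₀.IsPositive)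
    (hz : ∀ a, IsDec (D a) (z a)) (hz₀ : IsDec D₀ z₀)
    (hlim : ∀ j, Tendsto (fun a => z a j) U (𝓝 (z₀ j)))
    (hsum : Tendsto (fun a => ∑' j, ‖z a j‖ₑ ^ 2) U (𝓝 (∑' j, ‖z₀ j‖ₑ ^ 2)))
    (hfina : ∀ a, ∑' j, ‖z a j‖ₑ ^ 2 ≠ ∞) (hfin : ∑' j, ‖z₀ j‖ₑ ^ 2 ≠ ∞)
    (hent : Tendsto (fun a => ent fun j => ‖z a j‖ₑ ^ 2) U (𝓝 (ent fun j => ‖z₀ j‖ₑ ^ 2)))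
    (hentfin : (ent fun j => ‖z₀ j‖ₑ ^ 2) ≠ ∞) :
    Tendsto (fun a => qEntropy (D a)) U (𝓝 (qEntropy D₀)) := by
  obtain ⟨L, hL⟩ := exists_tendsto_ultrafilter U fun a => qEntropy (D a)
  have hT₀ : traceENN D₀ ≠ ∞ := by rwa [hz₀.traceENN_eq]
  have htr : Tendsto (fun a => traceENN (D a)) U (𝓝 (traceENN D₀)) := by
    simpa only [hz₀.traceENN_eq, (hz _).traceENN_eq] using hsum
  have hlow : qEntropy D₀ ≤ L := qEntropy_le_of_tendsto U hD hD₀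
    (fun a => by rw [(hz a).traceENN_eq]; exact hfina a) hT₀
    (tendsto_qf_of_isDec U hD hD₀ hz hz₀ hlim hsum hfin) htr hL
  have hup : L ≤ qEntropy D₀ := by
    refine le_iInf₂ fun s hs => ?_
    rw [clEntropy_qf hD₀ hT₀ hs]
    have h1 := ENNReal.tendsto_tsum_compl_atTop_zero hfin
    have h2 := ENNReal.tendsto_tsum_compl_atTop_zero
      (f := fun j => entTerm (traceENN D₀) (‖z₀ j‖ₑ ^ 2))
      (by rw [ent, ← hz₀.traceENN_eq] at hentfin; exact hentfin)
    have h3 := (tendsto_const_nhds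
      (x := ∑' v : s, entTerm (traceENN D₀) (ENNReal.ofReal (qf D₀ v)))).add (h1.add h2)
    rw [add_zero, add_zero] at h3
    exact ge_of_tendsto' h3 fun K =>
      qEntropy_limit_le U hD hz hz₀ hlim hsum hfina hfin hent hentfin hL K hs
  rwa [le_antisymm hlow hup]

end Continuity

section TraceNorm

variable {E : Type*} [NormedAddCommGroup E] [InnerProductSpace ℂ E] [CompleteSpace E]

theorem qf_add (A B : E →L[ℂ] E) (y : E) : qf (A + B) y = qf A y + qf B y := by
  simp [qf]

theorem qf_sub (A B : E →L[ℂ] E) (y : E) : qf (A - B) y = qf A y - qf B y := by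
  simp [qf]

theorem qf_ofReal_smul (c : ℝ) (A : E →L[ℂ] E) (y : E) : qf ((c : ℂ) • A) y = c * qf A y := by
  rw [qf, smul_apply, inner_smul_right, Complex.re_ofReal_mul]
  rfl

theorem qf_sum {ι : Type*} (K : Finset ι) (A : ι → E →L[ℂ] E) (y : E) :
    qf (∑ j ∈ K, A j) y = ∑ j ∈ K, qf (A j) y := by
  simp [qf, sum_apply]

theorem sum_le_traceNorm {n : ℕ} (A : E →L[ℂ] E) {e f : Fin n → E} (he : Orthonormal ℂ e)
    (hf : Orthonormal ℂ f) :
    ∑ i, ENNReal.ofReal ‖(inner ℂ (e i) (A (f i)) : ℂ)‖ ≤ traceNorm A :=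
  le_iSup_of_le n (le_iSup_of_le e (le_iSup_of_le f (le_iSup_of_le he (le_iSup_of_le hf le_rfl))))

theorem traceNorm_le {A : E →L[ℂ] E} {M : ℝ≥0∞} (h : ∀ (n : ℕ) (e f : Fin n → E),
    Orthonormal ℂ e → Orthonormal ℂ f → ∑ i, ENNReal.ofReal ‖(inner ℂ (e i) (A (f i)) : ℂ)‖ ≤ M) :
    traceNorm A ≤ M :=
  iSup_le fun n => iSup_le fun e => iSup_le fun f => iSup_le fun he => iSup_le fun hf =>
    h n e f he hf

theorem traceNorm_add_le (A B : E →L[ℂ] E) : traceNorm (A + B) ≤ traceNorm A + traceNorm B := by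
  refine traceNorm_le fun n e f he hf => ?_
  refine le_trans ?_ (add_le_add (sum_le_traceNorm A he hf) (sum_le_traceNorm B he hf))
  rw [← Finset.sum_add_distrib]
  refine Finset.sum_le_sum fun i _ => ?_
  rw [← ENNReal.ofReal_add (norm_nonneg _) (norm_nonneg _), add_apply, inner_add_right]
  exact ENNReal.ofReal_le_ofReal (norm_add_le _ _)

theorem traceNorm_smul_le (c : ℂ) (A : E →L[ℂ] E) :
    traceNorm (c • A) ≤ ENNReal.ofReal ‖c‖ * traceNorm A := by
  refine traceNorm_le fun n e f he hf => ?_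
  refine le_trans (le_of_eq ?_) (mul_le_mul_right (sum_le_traceNorm A he hf) _)
  rw [Finset.mul_sum]
  refine Finset.sum_congr rfl fun i _ => ?_
  rw [smul_apply, inner_smul_right, norm_mul, ENNReal.ofReal_mul (norm_nonneg _)]

theorem IsTC.add {A B : E →L[ℂ] E} (hA : IsTC A) (hB : IsTC B) : IsTC (A + B) :=
  ne_top_of_le_ne_top (ENNReal.add_ne_top.2 ⟨hA, hB⟩) (traceNorm_add_le A B)

theorem IsTC.smul {A : E →L[ℂ] E} (hA : IsTC A) (c : ℂ) : IsTC (c • A) :=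
  ne_top_of_le_ne_top (ENNReal.mul_ne_top ENNReal.ofReal_ne_top hA) (traceNorm_smul_le c A)

theorem IsTC.sub {A B : E →L[ℂ] E} (hA : IsTC A) (hB : IsTC B) : IsTC (A - B) := by
  simpa [sub_eq_add_neg] using hA.add (hB.smul (-1))

theorem isTC_zero : IsTC (0 : E →L[ℂ] E) := by
  simp [IsTC, traceNorm]

theorem IsTC.sum {ι : Type*} {K : Finset ι} {A : ι → E →L[ℂ] E} (hA : ∀ j ∈ K, IsTC (A j)) :
    IsTC (∑ j ∈ K, A j) :=
  Finset.sum_induction _ _ (fun _ _ => IsTC.add) isTC_zero hA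

theorem traceENN_le_add_traceNorm (A B : E →L[ℂ] E) :
    traceENN A ≤ traceENN B + traceNorm (A - B) := by
  refine iSup_le fun n => iSup_le fun e => iSup_le fun he => ?_
  refine le_trans ?_ (add_le_add (sum_qf_le_traceENN B he) (sum_le_traceNorm (A - B) he he))
  rw [← Finset.sum_add_distrib]
  refine Finset.sum_le_sum fun i _ => ?_
  have h : qf A (e i) ≤ qf B (e i) + ‖(inner ℂ (e i) ((A - B) (e i)) : ℂ)‖ := by
    have := Complex.re_le_norm (inner ℂ (e i) ((A - B) (e i)) : ℂ)
    have h2 : (inner ℂ (e i) ((A - B) (e i)) : ℂ).re = qf A (e i) - qf B (e i) := qf_sub A B _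
    linarith
  exact (ENNReal.ofReal_le_ofReal h).trans ENNReal.ofReal_add_le

theorem IsTC.traceENN_ne_top {A : E →L[ℂ] E} (hA : IsTC A) : traceENN A ≠ ∞ := by
  refine ne_top_of_le_ne_top hA ((traceENN_le_add_traceNorm A 0).trans (le_of_eq ?_))
  simp [traceENN, qf]

theorem traceNorm_neg (A : E →L[ℂ] E) : traceNorm (-A) = traceNorm A := by
  simp [traceNorm]

theorem enorm_inner_le_traceNorm (A : E →L[ℂ] E) (x y : E) :
    ‖(inner ℂ x (A y) : ℂ)‖ₑ ≤ traceNorm A * (‖x‖ₑ * ‖y‖ₑ) := by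
  rcases eq_or_ne x 0 with rfl | hx
  · simp
  rcases eq_or_ne y 0 with rfl | hy
  · simp
  have hu : ∀ v : E, v ≠ 0 → Orthonormal ℂ fun _ : Fin 1 => ((‖v‖⁻¹ : ℝ) : ℂ) • v := by
    intro v hv
    refine ⟨fun _ => ?_, fun i j hij => absurd (Subsingleton.elim i j) hij⟩
    rw [norm_smul, Complex.norm_real, norm_inv, norm_norm, inv_mul_cancel₀ (norm_ne_zero_iff.2 hv)]
  have h := sum_le_traceNorm A (hu x hx) (hu y hy)
  simp only [Finset.univ_unique, Finset.sum_singleton, map_smul, inner_smul_left, inner_smul_right,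
    norm_mul, Complex.conj_ofReal, Complex.norm_real, norm_inv, norm_norm] at h
  have hx' : 0 < ‖x‖ := norm_pos_iff.2 hx
  have hy' : 0 < ‖y‖ := norm_pos_iff.2 hy
  calc ‖(inner ℂ x (A y) : ℂ)‖ₑ
      = ENNReal.ofReal (‖y‖⁻¹ * (‖x‖⁻¹ * ‖(inner ℂ x (A y) : ℂ)‖)) * (‖x‖ₑ * ‖y‖ₑ) := by
        rw [← ofReal_norm, ← ofReal_norm, ← ofReal_norm, ← ENNReal.ofReal_mul hx'.le,
          ← ENNReal.ofReal_mul (by positivity)]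
        congr 1
        field_simp
    _ ≤ _ := by gcongr

theorem tendstoTN_iff {A : ℕ → E →L[ℂ] E} {A₀ : E →L[ℂ] E} :
    TendstoTN A A₀ ↔ Tendsto (fun n => traceNorm (A n - A₀)) atTop (𝓝 0) := by
  rw [ENNReal.tendsto_atTop_zero]
  constructor
  · intro h ε hε
    rcases eq_or_ne ε ∞ with rfl | hε'
    · exact ⟨0, fun n _ => le_top⟩
    · obtain ⟨N, hN⟩ := h ε.toReal (ENNReal.toReal_pos hε.ne' hε')
      exact ⟨N, fun n hn => (hN n hn).le.trans (ENNReal.ofReal_toReal hε').le⟩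
  · intro h ε hε
    obtain ⟨N, hN⟩ := h (ENNReal.ofReal (ε / 2)) (by simpa using hε)
    exact ⟨N, fun n hn => (hN n hn).trans_lt
      ((ENNReal.ofReal_lt_ofReal_iff hε).2 (half_lt_self hε))⟩

theorem TendstoTN.tendsto_inner {A : ℕ → E →L[ℂ] E} {A₀ : E →L[ℂ] E} (h : TendstoTN A A₀)
    (x y : E) : Tendsto (fun n => (inner ℂ x (A n y) : ℂ)) atTop (𝓝 (inner ℂ x (A₀ y))) := by
  rw [tendsto_iff_edist_tendsto_0]
  have h1 : Tendsto (fun n => traceNorm (A n - A₀) * (‖x‖ₑ * ‖y‖ₑ)) atTop (𝓝 0) := by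
    have := ENNReal.Tendsto.mul_const (b := ‖x‖ₑ * ‖y‖ₑ) (tendstoTN_iff.1 h)
      (Or.inr (by finiteness))
    simpa using this
  refine tendsto_of_tendsto_of_tendsto_of_le_of_le tendsto_const_nhds h1 (fun _ => zero_le)
    fun n => ?_
  have := enorm_inner_le_traceNorm (A n - A₀) x y
  rwa [sub_apply, inner_sub_right, ← edist_eq_enorm_sub] at this

theorem TendstoTN.tendsto_qf {A : ℕ → E →L[ℂ] E} {A₀ : E →L[ℂ] E} (h : TendstoTN A A₀) (y : E) :
    Tendsto (fun n => qf (A n) y) atTop (𝓝 (qf A₀ y)) :=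
  (Complex.continuous_re.tendsto _).comp (h.tendsto_inner y y)

theorem TendstoTN.tendsto_traceENN {A : ℕ → E →L[ℂ] E} {A₀ : E →L[ℂ] E} (h : TendstoTN A A₀)
    (hT₀ : traceENN A₀ ≠ ∞) :
    Tendsto (fun n => traceENN (A n)) atTop (𝓝 (traceENN A₀)) := by
  have h0 := tendstoTN_iff.1 h
  have hup : Tendsto (fun n => traceENN A₀ + traceNorm (A n - A₀)) atTop (𝓝 (traceENN A₀)) := by
    simpa using tendsto_const_nhds.add h0
  have hlow : Tendsto (fun n => traceENN A₀ - traceNorm (A n - A₀)) atTop (𝓝 (traceENN A₀)) := by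
    simpa using ENNReal.Tendsto.sub (tendsto_const_nhds (x := traceENN A₀)) h0 (Or.inl hT₀)
  refine tendsto_of_tendsto_of_tendsto_of_le_of_le hlow hup (fun n => ?_)
    fun n => traceENN_le_add_traceNorm _ _
  rw [tsub_le_iff_right]
  have := traceENN_le_add_traceNorm A₀ (A n)
  rwa [← traceNorm_neg, neg_sub] at this

theorem traceENN_mono {A B : E →L[ℂ] E} (h : ∀ y, qf A y ≤ qf B y) : traceENN A ≤ traceENN B :=
  iSup_le fun _ => iSup_le fun _ => iSup_le fun he =>
    (Finset.sum_le_sum fun _ _ => ENNReal.ofReal_le_ofReal (h _)).trans (sum_qf_le_traceENN B he)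

theorem traceENN_add_le (A B : E →L[ℂ] E) : traceENN (A + B) ≤ traceENN A + traceENN B := by
  refine iSup_le fun n => iSup_le fun e => iSup_le fun he => ?_
  refine le_trans ?_ (add_le_add (sum_qf_le_traceENN A he) (sum_qf_le_traceENN B he))
  rw [← Finset.sum_add_distrib]
  refine Finset.sum_le_sum fun i _ => ?_
  rw [qf_add]
  exact ENNReal.ofReal_add_le

theorem ofReal_qf_le_traceENN (A : E →L[ℂ] E) (y : E) :
    ENNReal.ofReal (qf A y) ≤ traceENN A * ‖y‖ₑ ^ 2 := by
  rcases eq_or_ne y 0 with rfl | hy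
  · simp [qf]
  have hy' : 0 < ‖y‖ := norm_pos_iff.2 hy
  have hu : Orthonormal ℂ fun _ : Fin 1 => ((‖y‖⁻¹ : ℝ) : ℂ) • y := by
    refine ⟨fun _ => ?_, fun i j hij => absurd (Subsingleton.elim i j) hij⟩
    rw [norm_smul, Complex.norm_real, norm_inv, norm_norm, inv_mul_cancel₀ hy'.ne']
  have h := sum_qf_le_traceENN A hu
  have hq : qf A (((‖y‖⁻¹ : ℝ) : ℂ) • y) = (‖y‖ ^ 2)⁻¹ * qf A y := by
    rw [qf, map_smul, inner_smul_left, inner_smul_right, Complex.conj_ofReal,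
      Complex.re_ofReal_mul, Complex.re_ofReal_mul, qf]
    field_simp
  simp only [Finset.univ_unique, Finset.sum_singleton, hq] at h
  calc ENNReal.ofReal (qf A y) = ENNReal.ofReal ((‖y‖ ^ 2)⁻¹ * qf A y) * ‖y‖ₑ ^ 2 := by
        rw [enorm_sq_eq_ofReal, ← ENNReal.ofReal_mul' (by positivity)]
        congr 1
        field_simp
    _ ≤ _ := by gcongr

end TraceNorm

section RankOne

variable {E F : Type*}
variable [NormedAddCommGroup E] [InnerProductSpace ℂ E] [CompleteSpace E]
variable [NormedAddCommGroup F] [InnerProductSpace ℂ F] [CompleteSpace F]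

theorem rankOne_apply (x y : E) : rankOne x y = (inner ℂ x y : ℂ) • x := rfl

theorem inner_rankOne (x y z : E) :
    (inner ℂ z (rankOne x y) : ℂ) = inner ℂ x y * inner ℂ z x := by
  rw [rankOne_apply, inner_smul_right]

theorem qf_rankOne (x y : E) : qf (rankOne x) y = ‖(inner ℂ x y : ℂ)‖ ^ 2 := by
  rw [qf, inner_rankOne, ← inner_conj_symm y x, Complex.mul_conj, Complex.ofReal_re,
    Complex.normSq_eq_norm_sq]

theorem rankOne_isPositive (x : E) : (rankOne x).IsPositive := by
  refine ContinuousLinearMap.isPositive_iff_complex _ |>.2 fun y => ?_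
  have h : (inner ℂ (rankOne x y) y : ℂ) = ((‖(inner ℂ x y : ℂ)‖ ^ 2 : ℝ) : ℂ) := by
    rw [← inner_conj_symm, inner_rankOne, ← inner_conj_symm y x, Complex.mul_conj,
      Complex.conj_ofReal, Complex.normSq_eq_norm_sq]
  rw [h]
  exact ⟨congrArg _ (Complex.ofReal_re _), (sq_nonneg _).trans_eq (Complex.ofReal_re _).symm⟩

theorem isDec_rankOne (x : E) : IsDec (rankOne x) fun _ : Unit => x := fun y => by
  simp only [qf_rankOne, enorm_sq_eq_ofReal, tsum_fintype, Finset.univ_unique,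
    Finset.sum_singleton]

theorem traceENN_rankOne (x : E) : traceENN (rankOne x) = ‖x‖ₑ ^ 2 := by
  rw [(isDec_rankOne x).traceENN_eq, tsum_fintype]
  simp

theorem qEntropy_rankOne (x : E) : qEntropy (rankOne x) = 0 := by
  refine le_antisymm (((isDec_rankOne x).qEntropy_le (rankOne_isPositive x) ?_).trans ?_) zero_le
  · rw [tsum_fintype]
    simp
  · simp [ent]

theorem rankOne_smul (c : ℝ) (x : E) : rankOne ((c : ℂ) • x) = ((c ^ 2 : ℝ) : ℂ) • rankOne x := by
  ext y
  rw [smul_apply, rankOne_apply, rankOne_apply, inner_smul_left, Complex.conj_ofReal, smul_smul,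
    smul_smul]
  push_cast
  ring_nf

theorem rankOne_zero : rankOne (0 : E) = 0 := by
  simpa using rankOne_smul 0 (0 : E)

theorem traceNorm_rankOne_le (x : E) : traceNorm (rankOne x) ≤ ‖x‖ₑ ^ 2 := by
  refine traceNorm_le fun n e f he hf => ?_
  rw [enorm_sq_eq_ofReal, ← ENNReal.ofReal_sum_of_nonneg fun _ _ => norm_nonneg _]
  refine ENNReal.ofReal_le_ofReal ?_
  have h1 := he.sum_inner_products_le x (s := Finset.univ)
  have h2 := hf.sum_inner_products_le x (s := Finset.univ)
  have h3 : ∑ i, ‖(inner ℂ (e i) (rankOne x (f i)) : ℂ)‖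
      ≤ ∑ i, (‖(inner ℂ (e i) x : ℂ)‖ ^ 2 + ‖(inner ℂ (f i) x : ℂ)‖ ^ 2) / 2 := by
    refine Finset.sum_le_sum fun i _ => ?_
    rw [inner_rankOne, norm_mul, norm_inner_symm x]
    nlinarith [sq_nonneg (‖(inner ℂ (e i) x : ℂ)‖ - ‖(inner ℂ (f i) x : ℂ)‖)]
  rw [← Finset.sum_div, Finset.sum_add_distrib] at h3
  linarith

theorem isTC_rankOne (x : E) : IsTC (rankOne x) :=
  ne_top_of_le_ne_top (by finiteness) (traceNorm_rankOne_le x)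

/-- The difference of two rank-one projections is a difference of two small ones. -/
theorem exists_rankOne_add_eq (x y : E) : ∃ v w : E,
    rankOne x + rankOne w = rankOne y + rankOne v ∧
      ‖v‖ ^ 2 ≤ ‖x - y‖ * (‖x + y‖ + 1) ^ 2 ∧ ‖w‖ ^ 2 ≤ ‖x - y‖ * (‖x + y‖ + 1) ^ 2 := by
  rcases eq_or_ne x y with rfl | hxy
  · exact ⟨0, 0, rfl, by simp, by simp⟩
  have hd : 0 < ‖x - y‖ := norm_pos_iff.2 (sub_ne_zero.2 hxy)
  obtain ⟨r, hr, hr2⟩ : ∃ r : ℝ, 0 < r ∧ r ^ 2 = ‖x - y‖ :=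
    ⟨√‖x - y‖, Real.sqrt_pos.2 hd, Real.sq_sqrt hd.le⟩
  have hr0 : (r : ℂ) ≠ 0 := by exact_mod_cast hr.ne'
  have ha : ‖(r : ℂ) • (x + y)‖ = r * ‖x + y‖ := by
    rw [norm_smul, Complex.norm_real, Real.norm_of_nonneg hr.le]
  have hb : ‖((r⁻¹ : ℝ) : ℂ) • (x - y)‖ = r := by
    rw [norm_smul, Complex.norm_real, Real.norm_of_nonneg (by positivity), ← hr2]
    field_simp
  have hbound : ∀ v : E, ‖v‖ ≤ r * ‖x + y‖ + r →
      ‖((1 / 2 : ℝ) : ℂ) • v‖ ^ 2 ≤ ‖x - y‖ * (‖x + y‖ + 1) ^ 2 := fun v hv => by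
    have h : ‖v‖ ^ 2 ≤ (r * ‖x + y‖ + r) ^ 2 := by gcongr
    rw [norm_smul, Complex.norm_real, Real.norm_of_nonneg (by norm_num), ← hr2, mul_pow]
    nlinarith [sq_nonneg ‖v‖]
  refine ⟨((1 / 2 : ℝ) : ℂ) • ((r : ℂ) • (x + y) + ((r⁻¹ : ℝ) : ℂ) • (x - y)),
    ((1 / 2 : ℝ) : ℂ) • ((r : ℂ) • (x + y) - ((r⁻¹ : ℝ) : ℂ) • (x - y)), ?_,
    hbound _ ((norm_add_le _ _).trans_eq (by rw [ha, hb])),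
    hbound _ ((norm_sub_le _ _).trans_eq (by rw [ha, hb]))⟩
  ext z
  simp only [add_apply, rankOne_apply, inner_smul_left, inner_add_left, inner_sub_left,
    Complex.conj_ofReal]
  push_cast
  match_scalars <;> field_simp <;> ring

theorem tendsto_rankOne_gap {α : Type*} {l : Filter α} {x : α → E} {x₀ : E}
    (hx : Tendsto x l (𝓝 x₀)) :
    Tendsto (fun a => ‖x a - x₀‖ * (‖x a + x₀‖ + 1) ^ 2) l (𝓝 0) := by
  have h : Continuous fun y : E => ‖y - x₀‖ * (‖y + x₀‖ + 1) ^ 2 := by fun_prop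
  simpa [Function.comp_def] using (h.tendsto x₀).comp hx

theorem tendstoTN_rankOne {x : ℕ → E} {x₀ : E} (hx : Tendsto x atTop (𝓝 x₀)) :
    TendstoTN (fun n => rankOne (x n)) (rankOne x₀) := by
  rw [tendstoTN_iff]
  have h := ENNReal.tendsto_ofReal (tendsto_rankOne_gap hx)
  have h2 := h.add h
  rw [ENNReal.ofReal_zero, add_zero] at h2
  refine tendsto_of_tendsto_of_tendsto_of_le_of_le tendsto_const_nhds h2 (fun _ => zero_le)
    fun n => ?_
  obtain ⟨v, w, hvw, hv, hw⟩ := exists_rankOne_add_eq (x n) x₀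
  have he : rankOne (x n) - rankOne x₀ = rankOne v + -rankOne w := by
    rw [← sub_eq_add_neg, sub_eq_sub_iff_add_eq_add, hvw, add_comm]
  refine (congrArg traceNorm he).le.trans ((traceNorm_add_le _ _).trans ?_)
  rw [traceNorm_neg]
  refine add_le_add ((traceNorm_rankOne_le v).trans ?_) ((traceNorm_rankOne_le w).trans ?_) <;>
    rw [enorm_sq_eq_ofReal] <;> gcongr

theorem clEntropy_const_mul {ι : Type*} {c : ℝ} (hc : 0 < c) (x : ι → ℝ) :
    clEntropy (fun i => c * x i) = ENNReal.ofReal c * clEntropy x := by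
  simp only [clEntropy, tsum_mul_left, ENNReal.ofReal_mul hc.le, mul_div_mul_left _ _ hc.ne',
    mul_assoc]

theorem qEntropy_ofReal_smul {c : ℝ} (hc : 0 < c) (A : E →L[ℂ] E) :
    qEntropy ((c : ℂ) • A) = ENNReal.ofReal c * qEntropy A := by
  have hc0 : ENNReal.ofReal c ≠ 0 := (ENNReal.ofReal_pos.2 hc).ne'
  simp only [qEntropy, qf_ofReal_smul, clEntropy_const_mul hc,
    ENNReal.mul_iInf_of_ne hc0 ENNReal.ofReal_ne_top]

namespace TraceMap

variable (Ψ : TraceMap E F)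

theorem map_zero : Ψ.toFun 0 = 0 := by
  simpa using Ψ.map_smul 0 0 isTC_zero

theorem map_sum {ι : Type*} (K : Finset ι) {A : ι → E →L[ℂ] E} (hA : ∀ j ∈ K, IsTC (A j)) :
    Ψ.toFun (∑ j ∈ K, A j) = ∑ j ∈ K, Ψ.toFun (A j) := by
  induction K using Finset.induction_on with
  | empty => simpa using Ψ.map_zero
  | insert a s ha ih =>
    have hs : ∀ j ∈ s, IsTC (A j) := fun j hj => hA j (Finset.mem_insert_of_mem hj)
    rw [Finset.sum_insert ha, Finset.sum_insert ha,
      Ψ.map_add _ _ (hA a (Finset.mem_insert_self a s)) (IsTC.sum hs), ih hs]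

theorem map_rankOne_smul (c : ℝ) (x : E) :
    Ψ.toFun (rankOne ((c : ℂ) • x)) = ((c ^ 2 : ℝ) : ℂ) • Ψ.toFun (rankOne x) := by
  rw [rankOne_smul, Ψ.map_smul _ _ (isTC_rankOne x)]

theorem isPositive_rankOne (x : E) : (Ψ.toFun (rankOne x)).IsPositive :=
  Ψ.pos _ (isTC_rankOne x) (rankOne_isPositive x)

variable {Ψ}

theorem TNI.traceENN_rankOne_le (hΨ : Ψ.TNI) (x : E) : traceENN (Ψ.toFun (rankOne x)) ≤ ‖x‖ₑ ^ 2 :=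
  (hΨ _ (isTC_rankOne x) (rankOne_isPositive x)).trans_eq (traceENN_rankOne x)

theorem TNI.qf_rankOne_le (hΨ : Ψ.TNI) (x : E) (y : F) :
    qf (Ψ.toFun (rankOne x)) y ≤ ‖x‖ ^ 2 * ‖y‖ ^ 2 := by
  have h := (ofReal_qf_le_traceENN (Ψ.toFun (rankOne x)) y).trans
    (mul_le_mul_left (hΨ.traceENN_rankOne_le x) _)
  rw [enorm_sq_eq_ofReal, enorm_sq_eq_ofReal, ← ENNReal.ofReal_mul (by positivity)] at h
  exact (ENNReal.ofReal_le_ofReal_iff (by positivity)).1 h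

theorem exists_qf_rankOne_le (x y : E) : ∃ v : E, ‖v‖ ^ 2 ≤ ‖x - y‖ * (‖x + y‖ + 1) ^ 2 ∧
    ∀ z, qf (Ψ.toFun (rankOne x)) z ≤ qf (Ψ.toFun (rankOne y) + Ψ.toFun (rankOne v)) z := by
  obtain ⟨v, w, hvw, hv, -⟩ := exists_rankOne_add_eq x y
  refine ⟨v, hv, fun z => ?_⟩
  rw [← Ψ.map_add _ _ (isTC_rankOne y) (isTC_rankOne v), ← hvw,
    Ψ.map_add _ _ (isTC_rankOne x) (isTC_rankOne w), qf_add]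
  linarith [qf_nonneg (Ψ.isPositive_rankOne w) z]

theorem TNI.traceENN_rankOne_le_add (hΨ : Ψ.TNI) (x y : E) : traceENN (Ψ.toFun (rankOne x)) ≤
    traceENN (Ψ.toFun (rankOne y)) + ENNReal.ofReal (‖x - y‖ * (‖x + y‖ + 1) ^ 2) := by
  obtain ⟨v, hv, h⟩ := Ψ.exists_qf_rankOne_le x y
  refine (traceENN_mono h).trans ((traceENN_add_le _ _).trans ?_)
  gcongr
  refine (hΨ.traceENN_rankOne_le v).trans ?_
  rw [enorm_sq_eq_ofReal]
  gcongr

theorem TNI.qf_rankOne_le_add (hΨ : Ψ.TNI) (x y : E) (z : F) : qf (Ψ.toFun (rankOne x)) z ≤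
    qf (Ψ.toFun (rankOne y)) z + ‖x - y‖ * (‖x + y‖ + 1) ^ 2 * ‖z‖ ^ 2 := by
  obtain ⟨v, hv, h⟩ := Ψ.exists_qf_rankOne_le x y
  have h1 := h z
  rw [qf_add] at h1
  have h2 := hΨ.qf_rankOne_le v z
  have h3 : ‖v‖ ^ 2 * ‖z‖ ^ 2 ≤ ‖x - y‖ * (‖x + y‖ + 1) ^ 2 * ‖z‖ ^ 2 := by gcongr
  linarith

end TraceMap

end RankOne

section Convergence

variable {E F : Type*}
variable [NormedAddCommGroup E] [InnerProductSpace ℂ E] [CompleteSpace E]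
variable [NormedAddCommGroup F] [InnerProductSpace ℂ F] [CompleteSpace F]

theorem TendstoTN.smul {A : ℕ → E →L[ℂ] E} {A₀ : E →L[ℂ] E} (h : TendstoTN A A₀) (c : ℂ) :
    TendstoTN (fun n => c • A n) (c • A₀) := by
  rw [tendstoTN_iff] at h ⊢
  have h1 : Tendsto (fun n => ENNReal.ofReal ‖c‖ * traceNorm (A n - A₀)) atTop (𝓝 0) := by
    simpa using ENNReal.Tendsto.const_mul (a := ENNReal.ofReal ‖c‖) h
      (Or.inr ENNReal.ofReal_ne_top)
  refine tendsto_of_tendsto_of_tendsto_of_le_of_le tendsto_const_nhds h1 (fun _ => zero_le)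
    fun n => ?_
  simpa only [smul_sub] using traceNorm_smul_le c (A n - A₀)

section StrongLimit

variable {Φ : ℕ → TraceMap E F} {Φ₀ : TraceMap E F}

theorem tendstoTN_map_rankOne
    (hconv : ∀ ρ ∈ states E, TendstoTN (fun n => (Φ n).toFun ρ) (Φ₀.toFun ρ)) (x : E) :
    TendstoTN (fun n => (Φ n).toFun (rankOne x)) (Φ₀.toFun (rankOne x)) := by
  rcases eq_or_ne x 0 with rfl | hx
  · rw [tendstoTN_iff, rankOne_zero]
    simp [TraceMap.map_zero, traceNorm]
  have hx' : 0 < ‖x‖ := norm_pos_iff.2 hx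
  set u : E := ((‖x‖⁻¹ : ℝ) : ℂ) • x with hu
  have hxu : x = ((‖x‖ : ℝ) : ℂ) • u := by
    rw [hu, smul_smul, ← Complex.ofReal_mul, mul_inv_cancel₀ hx'.ne', Complex.ofReal_one, one_smul]
  have hstate : rankOne u ∈ states E := by
    refine ⟨rankOne_isPositive u, ?_⟩
    rw [traceENN_rankOne, enorm_sq_eq_ofReal, hu, norm_smul, Complex.norm_real, norm_inv, norm_norm,
      inv_mul_cancel₀ hx'.ne']
    simp
  rw [hxu]
  simpa only [TraceMap.map_rankOne_smul] using (hconv _ hstate).smul ((‖x‖ ^ 2 : ℝ) : ℂ)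

theorem tendsto_qf_map_rankOne (hTNI : ∀ n, (Φ n).TNI)
    (hconv : ∀ ρ ∈ states E, TendstoTN (fun n => (Φ n).toFun ρ) (Φ₀.toFun ρ))
    {l : Filter ℕ} (hl : l ≤ atTop) {x : ℕ → E} {x₀ : E} (hx : Tendsto x l (𝓝 x₀)) (z : F) :
    Tendsto (fun n => qf ((Φ n).toFun (rankOne (x n))) z) l
      (𝓝 (qf (Φ₀.toFun (rankOne x₀)) z)) := by
  have h := ((tendstoTN_map_rankOne hconv x₀).tendsto_qf z).mono_left hl
  have hg := (tendsto_rankOne_gap hx).mul_const (‖z‖ ^ 2)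
  rw [zero_mul] at hg
  refine tendsto_of_tendsto_of_tendsto_of_le_of_le (by simpa using h.sub hg)
    (by simpa using h.add hg) (fun n => ?_) fun n => (hTNI n).qf_rankOne_le_add (x n) x₀ z
  have := (hTNI n).qf_rankOne_le_add x₀ (x n) z
  rw [norm_sub_rev, add_comm x₀] at this
  exact sub_le_iff_le_add.2 this

theorem tendsto_traceENN_map_rankOne (hTNI : ∀ n, (Φ n).TNI)
    (hconv : ∀ ρ ∈ states E, TendstoTN (fun n => (Φ n).toFun ρ) (Φ₀.toFun ρ))
    {l : Filter ℕ} (hl : l ≤ atTop) {x : ℕ → E} {x₀ : E} (hx : Tendsto x l (𝓝 x₀)) :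
    Tendsto (fun n => traceENN ((Φ n).toFun (rankOne (x n)))) l
      (𝓝 (traceENN (Φ₀.toFun (rankOne x₀)))) := by
  have hT₀ := (Φ₀.maps_tc _ (isTC_rankOne x₀)).traceENN_ne_top
  have h := ((tendstoTN_map_rankOne hconv x₀).tendsto_traceENN hT₀).mono_left hl
  have hg := ENNReal.tendsto_ofReal (tendsto_rankOne_gap hx)
  rw [ENNReal.ofReal_zero] at hg
  have hlow := ENNReal.Tendsto.sub h hg (Or.inl hT₀)
  have hup := h.add hg
  rw [tsub_zero] at hlow
  rw [add_zero] at hup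
  refine tendsto_of_tendsto_of_tendsto_of_le_of_le hlow hup (fun n => ?_) fun n => (hTNI n).traceENN_rankOne_le_add (x n) x₀
  have := (hTNI n).traceENN_rankOne_le_add x₀ (x n)
  rw [norm_sub_rev, add_comm x₀] at this
  exact tsub_le_iff_right.2 this

end StrongLimit

theorem IsDec.sub_sum {A : E →L[ℂ] E} (hA : A.IsPositive) {x : ℕ → E} (hx : IsDec A x) (m : ℕ) :
    (A - ∑ j ∈ Finset.range m, rankOne (x j)).IsPositive ∧
      IsDec (A - ∑ j ∈ Finset.range m, rankOne (x j)) fun j => x (j + m) := by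
  have hqf : ∀ y, qf (A - ∑ j ∈ Finset.range m, rankOne (x j)) y =
      qf A y - ∑ j ∈ Finset.range m, ‖(inner ℂ (x j) y : ℂ)‖ ^ 2 := fun y => by
    simp only [qf_sub, qf_sum, qf_rankOne]
  have hsum : ∀ y, ENNReal.ofReal (∑ j ∈ Finset.range m, ‖(inner ℂ (x j) y : ℂ)‖ ^ 2) +
      ∑' j, ‖(inner ℂ (x (j + m)) y : ℂ)‖ₑ ^ 2 = ENNReal.ofReal (qf A y) := fun y => by
    rw [ENNReal.ofReal_sum_of_nonneg fun _ _ => by positivity, ← hx y]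
    simp_rw [← enorm_sq_eq_ofReal]
    exact ENNReal.summable.sum_add_tsum_nat_add'
      (f := fun j => ‖(inner ℂ (x j) y : ℂ)‖ₑ ^ 2)
  refine ⟨⟨?_, fun y => ?_⟩, fun y => ?_⟩
  · refine (hA.isSelfAdjoint.sub ?_).isSymmetric
    exact isSelfAdjoint_sum _ fun j _ => (rankOne_isPositive (x j)).isSelfAdjoint
  · have h : qf (A - ∑ j ∈ Finset.range m, rankOne (x j)) y =
        (A - ∑ j ∈ Finset.range m, rankOne (x j)).reApplyInnerSelf y := by
      rw [qf, ContinuousLinearMap.reApplyInnerSelf_apply, inner_re_symm]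
      rfl
    rw [← h, hqf, sub_nonneg]
    exact (ENNReal.ofReal_le_ofReal_iff (qf_nonneg hA y)).1 (le_self_add.trans_eq (hsum y))
  · rw [hqf, ENNReal.ofReal_sub _ (by positivity), ← hsum y,
      ENNReal.add_sub_cancel_left ENNReal.ofReal_ne_top]

namespace TraceMap

variable {Ψ : TraceMap E F}

/-- A trace-non-increasing positive map is countably additive on decompositions. -/
theorem TNI.tsum_qf_rankOne (hΨ : Ψ.TNI) {A : E →L[ℂ] E} (hA : A ∈ posTC E) {x : ℕ → E}
    (hx : IsDec A x) (v : F) :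
    ∑' j, ENNReal.ofReal (qf (Ψ.toFun (rankOne (x j))) v) = ENNReal.ofReal (qf (Ψ.toFun A) v) := by
  have hfin : ∑' j, ‖x j‖ₑ ^ 2 ≠ ∞ := by
    rw [← hx.traceENN_eq]
    exact hA.2.traceENN_ne_top
  have hSTC : ∀ m, IsTC (∑ j ∈ Finset.range m, rankOne (x j)) := fun m =>
    IsTC.sum fun j _ => isTC_rankOne (x j)
  have hRTC : ∀ m, IsTC (A - ∑ j ∈ Finset.range m, rankOne (x j)) := fun m => hA.2.sub (hSTC m)
  have heq : ∀ m, ∑ j ∈ Finset.range m, ENNReal.ofReal (qf (Ψ.toFun (rankOne (x j))) v) +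
      ENNReal.ofReal (qf (Ψ.toFun (A - ∑ j ∈ Finset.range m, rankOne (x j))) v) =
        ENNReal.ofReal (qf (Ψ.toFun A) v) := fun m => by
    have hnn : ∀ j, 0 ≤ qf (Ψ.toFun (rankOne (x j))) v := fun j =>
      qf_nonneg (Ψ.isPositive_rankOne (x j)) v
    rw [← ENNReal.ofReal_sum_of_nonneg fun j _ => hnn j,
      ← ENNReal.ofReal_add (Finset.sum_nonneg fun j _ => hnn j)
        (qf_nonneg (Ψ.pos _ (hRTC m) (hx.sub_sum hA.1 m).1) v),
      ← qf_sum, ← Ψ.map_sum _ fun j _ => isTC_rankOne (x j), ← qf_add,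
      ← Ψ.map_add _ _ (hSTC m) (hRTC m), add_sub_cancel]
  have htail : Tendsto (fun m => ENNReal.ofReal
      (qf (Ψ.toFun (A - ∑ j ∈ Finset.range m, rankOne (x j))) v)) atTop (𝓝 0) := by
    have h1 : Tendsto (fun m => (∑' j, ‖x (j + m)‖ₑ ^ 2) * ‖v‖ₑ ^ 2) atTop (𝓝 0) := by
      simpa using ENNReal.Tendsto.mul_const (b := ‖v‖ₑ ^ 2) (ENNReal.tendsto_sum_nat_add _ hfin)
        (Or.inr (by finiteness))
    refine tendsto_of_tendsto_of_tendsto_of_le_of_le tendsto_const_nhds h1 (fun _ => zero_le)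
      fun m => (ofReal_qf_le_traceENN _ v).trans ?_
    gcongr
    rw [← (hx.sub_sum hA.1 m).2.traceENN_eq]
    exact hΨ _ (hRTC m) (hx.sub_sum hA.1 m).1
  have hlim := (ENNReal.tendsto_nat_tsum fun j =>
    ENNReal.ofReal (qf (Ψ.toFun (rankOne (x j))) v)).add htail
  simp_rw [heq, add_zero] at hlim
  exact tendsto_nhds_unique hlim tendsto_const_nhds

theorem TNI.isDec_map (hΨ : Ψ.TNI) {A : E →L[ℂ] E} (hA : A ∈ posTC E) {x : ℕ → E}
    (hx : IsDec A x) {y : ℕ → ℕ → F} (hy : ∀ j, IsDec (Ψ.toFun (rankOne (x j))) (y j)) :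
    IsDec (Ψ.toFun A) fun p : ℕ × ℕ => y p.1 p.2 := fun v => by
  rw [ENNReal.tsum_prod (f := fun j i => ‖(inner ℂ (y j i) v : ℂ)‖ₑ ^ 2),
    ← hΨ.tsum_qf_rankOne hA hx v]
  exact tsum_congr fun j => hy j v

end TraceMap

end Convergence

section OutputEntropy

/-- Convergence along all sequences of arguments is joint convergence. -/
theorem tendsto_prod_of_forall_seq {X Y : Type*} [TopologicalSpace X] [FirstCountableTopology X]
    [TopologicalSpace Y] {f : ℕ → X → Y} {x₀ : X} {y : Y}
    (h : ∀ x : ℕ → X, Tendsto x atTop (𝓝 x₀) → Tendsto (fun n => f n (x n)) atTop (𝓝 y)) :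
    Tendsto (fun p : ℕ × X => f p.1 p.2) (atTop ×ˢ 𝓝 x₀) (𝓝 y) := by
  refine tendsto_of_subseq_tendsto fun u hu => ?_
  have hu1 : Tendsto (fun k => (u k).1) atTop atTop := tendsto_fst.comp hu
  have hu2 : Tendsto (fun k => (u k).2) atTop (𝓝 x₀) := tendsto_snd.comp hu
  obtain ⟨φ, hφ, hmono⟩ := strictMono_subseq_of_tendsto_atTop hu1
  refine ⟨φ, ?_⟩
  set m : ℕ → ℕ := fun k => (u (φ k)).1 with hm
  have hmono' : StrictMono m := hmono
  set x : ℕ → X := Function.extend m (fun k => (u (φ k)).2) fun _ => x₀ with hx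
  have hxm : ∀ k, x (m k) = (u (φ k)).2 := fun k => hmono'.injective.extend_apply _ _ k
  have hlim : Tendsto x atTop (𝓝 x₀) := by
    intro W hW
    obtain ⟨K, hK⟩ := eventually_atTop.1 ((hu2.comp hφ.tendsto_atTop).eventually_mem hW)
    refine mem_atTop_sets.2 ⟨m K, fun n hn => ?_⟩
    rw [Set.mem_preimage]
    by_cases hex : ∃ k, m k = n
    · obtain ⟨k, rfl⟩ := hex
      rw [hxm]
      exact hK k (hmono'.le_iff_le.1 hn)
    · rw [hx, Function.extend_apply' _ _ _ hex]
      exact mem_of_mem_nhds hW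
  refine ((h x hlim).comp hmono'.tendsto_atTop).congr fun k => ?_
  rw [Function.comp_apply, hxm]

theorem tendsto_apply_of_tendsto_prod {X Y : Type*} [TopologicalSpace X] [TopologicalSpace Y]
    {f : ℕ → X → Y} {x₀ : X} {y : Y}
    (h : Tendsto (fun p : ℕ × X => f p.1 p.2) (atTop ×ˢ 𝓝 x₀) (𝓝 y)) {l : Filter ℕ}
    (hl : l ≤ atTop) {x : ℕ → X} (hx : Tendsto x l (𝓝 x₀)) :
    Tendsto (fun n => f n (x n)) l (𝓝 y) :=
  h.comp ((tendsto_id'.2 hl).prodMk hx)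

theorem ent_prod {ι κ : Type*} (Y : ι → κ → ℝ≥0∞) (hY : ∑' j, ∑' i, Y j i ≠ ∞) :
    (ent fun p : ι × κ => Y p.1 p.2) =
      ∑' j, (entTerm (∑' j, ∑' i, Y j i) (∑' i, Y j i) + ent (Y j)) := by
  rw [ent, ENNReal.tsum_prod (f := Y),
    ENNReal.tsum_prod (f := fun j i => entTerm (∑' j, ∑' i, Y j i) (Y j i))]
  exact tsum_congr fun j => tsum_entTerm_chain hY (Y j)
    (ENNReal.le_tsum (f := fun j => ∑' i, Y j i) j)

theorem tendsto_tsum_entTerm_add {α ι : Type*} {l : Filter α} [l.NeBot] {p q h : α → ι → ℝ≥0∞}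
    {p₀ q₀ h₀ : ι → ℝ≥0∞} {C : ℝ≥0∞} (hC : C ≠ ∞)
    (hp : ∀ j, Tendsto (fun a => p a j) l (𝓝 (p₀ j)))
    (hq : ∀ j, Tendsto (fun a => q a j) l (𝓝 (q₀ j)))
    (hh : ∀ j, Tendsto (fun a => h a j) l (𝓝 (h₀ j)))
    (hqp : ∀ a j, q a j ≤ p a j) (hhp : ∀ᶠ a in l, ∀ j, h a j ≤ C * p a j)
    (hP : Tendsto (fun a => ∑' j, p a j) l (𝓝 (∑' j, p₀ j)))
    (hPa : ∀ a, ∑' j, p a j ≠ ∞) (hP₀ : ∑' j, p₀ j ≠ ∞)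
    (hent : Tendsto (fun a => ent (p a)) l (𝓝 (ent p₀))) (hent₀ : ent p₀ ≠ ∞) :
    Tendsto (fun a => ∑' j, q a j) l (𝓝 (∑' j, q₀ j)) ∧
    Tendsto (fun a => ∑' j, (entTerm (∑' j, q a j) (q a j) + h a j)) l
      (𝓝 (∑' j, (entTerm (∑' j, q₀ j) (q₀ j) + h₀ j))) ∧
    ∑' j, (entTerm (∑' j, q₀ j) (q₀ j) + h₀ j) ≠ ∞ := by
  have hqp₀ : ∀ j, q₀ j ≤ p₀ j := fun j =>
    le_of_tendsto_of_tendsto' (hq j) (hp j) fun a => hqp a j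
  have hQ₀ : ∑' j, q₀ j ≠ ∞ := ne_top_of_le_ne_top hP₀ (ENNReal.tsum_le_tsum hqp₀)
  have hQ : Tendsto (fun a => ∑' j, q a j) l (𝓝 (∑' j, q₀ j)) :=
    tendsto_tsum_of_dominated_tendsto hq hp (Eventually.of_forall hqp) hP hP₀
  have hle : ∀ (r : ι → ℝ≥0∞) (j : ι), r j ≤ ∑' j, r j := fun r j => ENNReal.le_tsum j
  have hf : ∀ j, Tendsto (fun a => entTerm (∑' j, q a j) (q a j) + h a j) l
      (𝓝 (entTerm (∑' j, q₀ j) (q₀ j) + h₀ j)) := fun j =>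
    (tendsto_entTerm hQ (hq j) (fun a => hle (q a) j) (hle q₀ j) hQ₀).add (hh j)
  have hg : ∀ j, Tendsto (fun a => entTerm (∑' j, p a j) (p a j) + p a j + C * p a j) l
      (𝓝 (entTerm (∑' j, p₀ j) (p₀ j) + p₀ j + C * p₀ j)) := fun j =>
    ((tendsto_entTerm hP (hp j) (fun a => hle (p a) j) (hle p₀ j) hP₀).add (hp j)).add
      (ENNReal.Tendsto.const_mul (hp j) (Or.inr hC))
  have hfg : ∀ᶠ a in l, ∀ j, entTerm (∑' j, q a j) (q a j) + h a j ≤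
      entTerm (∑' j, p a j) (p a j) + p a j + C * p a j := by
    filter_upwards [hhp] with a ha j
    exact add_le_add (entTerm_le_add (hqp a j) (hle (p a) j) (ENNReal.tsum_le_tsum (hqp a))
      (hle (q a) j) (hPa a)) (ha j)
  have hgsum : ∀ r : ι → ℝ≥0∞, ∑' j, (entTerm (∑' j, r j) (r j) + r j + C * r j) =
      ent r + ∑' j, r j + C * ∑' j, r j := fun r => by
    rw [ENNReal.tsum_add, ENNReal.tsum_add, ENNReal.tsum_mul_left, ent]
  have hgfin : ∑' j, (entTerm (∑' j, p₀ j) (p₀ j) + p₀ j + C * p₀ j) ≠ ∞ := by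
    rw [hgsum]
    finiteness
  have hG : Tendsto (fun a => ∑' j, (entTerm (∑' j, p a j) (p a j) + p a j + C * p a j)) l
      (𝓝 (∑' j, (entTerm (∑' j, p₀ j) (p₀ j) + p₀ j + C * p₀ j))) := by
    simp_rw [hgsum]
    exact (hent.add hP).add (ENNReal.Tendsto.const_mul hP (Or.inr hC))
  exact ⟨hQ, tendsto_tsum_of_dominated_tendsto hf hg hfg hG hgfin, ne_top_of_le_ne_top hgfin
    (ENNReal.tsum_le_tsum fun j =>
      le_of_tendsto_of_tendsto (hf j) (hg j) (hfg.mono fun a ha => ha j))⟩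

variable {E F : Type*}
variable [NormedAddCommGroup E] [InnerProductSpace ℂ E] [CompleteSpace E]
variable [NormedAddCommGroup F] [InnerProductSpace ℂ F] [CompleteSpace F]
variable {Φ : ℕ → TraceMap E F} {Φ₀ : TraceMap E F}

theorem exists_qEntropy_map_rankOne_le
    (hjoint : Tendsto (fun p : ℕ × E => qEntropy ((Φ p.1).toFun (rankOne p.2))) (atTop ×ˢ 𝓝 0)
      (𝓝 (qEntropy (Φ₀.toFun (rankOne 0))))) :
    ∃ C : ℝ≥0∞, C ≠ ∞ ∧
      ∀ᶠ n in atTop, ∀ x : E, qEntropy ((Φ n).toFun (rankOne x)) ≤ C * ‖x‖ₑ ^ 2 := by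
  have h0 : qEntropy (0 : F →L[ℂ] F) = 0 := by rw [← rankOne_zero, qEntropy_rankOne]
  rw [rankOne_zero, Φ₀.map_zero, h0] at hjoint
  have hev := hjoint.eventually_lt_const (zero_lt_one (α := ℝ≥0∞))
  obtain ⟨s, hs, t, ht, hst⟩ := eventually_prod_iff.1 hev
  obtain ⟨r, hr, hball⟩ := Metric.eventually_nhds_iff.1 ht
  refine ⟨ENNReal.ofReal (4 / r ^ 2), ENNReal.ofReal_ne_top, hs.mono fun n hn x => ?_⟩
  rcases eq_or_ne x 0 with rfl | hx
  · simp [rankOne_zero, TraceMap.map_zero, h0]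
  have hx' : 0 < ‖x‖ := norm_pos_iff.2 hx
  set c : ℝ := r / (2 * ‖x‖) with hc
  have hcpos : 0 < c := by positivity
  have hsmall : t ((c : ℂ) • x) := hball (by
    rw [dist_zero_right, norm_smul, Complex.norm_real, Real.norm_of_nonneg hcpos.le, hc]
    field_simp
    linarith)
  have h1 := hst hn hsmall
  simp only [TraceMap.map_rankOne_smul] at h1
  rw [qEntropy_ofReal_smul (by positivity)] at h1
  calc qEntropy ((Φ n).toFun (rankOne x))
      = ENNReal.ofReal (4 / r ^ 2) * ‖x‖ₑ ^ 2 *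
          (ENNReal.ofReal (c ^ 2) * qEntropy ((Φ n).toFun (rankOne x))) := by
        rw [← mul_assoc, enorm_sq_eq_ofReal, ← ENNReal.ofReal_mul (by positivity),
          ← ENNReal.ofReal_mul (by positivity)]
        have h2 : 4 / r ^ 2 * ‖x‖ ^ 2 * c ^ 2 = 1 := by
          rw [hc]
          field_simp
          norm_num
        rw [h2, ENNReal.ofReal_one, one_mul]
    _ ≤ ENNReal.ofReal (4 / r ^ 2) * ‖x‖ₑ ^ 2 * 1 := by gcongr
    _ = _ := mul_one _

theorem tendsto_qEntropy_map_ultrafilter (hTNI : ∀ n, (Φ n).TNI) (hTNI₀ : Φ₀.TNI)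
    (hconv : ∀ ρ ∈ states E, TendstoTN (fun n => (Φ n).toFun ρ) (Φ₀.toFun ρ))
    (hjoint : ∀ x₀ : E, Tendsto (fun p : ℕ × E => qEntropy ((Φ p.1).toFun (rankOne p.2)))
      (atTop ×ˢ 𝓝 x₀) (𝓝 (qEntropy (Φ₀.toFun (rankOne x₀)))))
    {A : ℕ → E →L[ℂ] E} {A₀ : E →L[ℂ] E} (hA : ∀ n, A n ∈ posTC E) (hA₀ : A₀ ∈ posTC E)
    (hlim : TendstoTN A A₀) (hH₀ : qEntropy A₀ ≠ ∞)
    (hH : Tendsto (fun n => qEntropy (A n)) atTop (𝓝 (qEntropy A₀)))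
    (U : Ultrafilter ℕ) (hU : (U : Filter ℕ) ≤ atTop) :
    qEntropy (Φ₀.toFun A₀) ≠ ∞ ∧
      Tendsto (fun n => qEntropy ((Φ n).toFun (A n))) U (𝓝 (qEntropy (Φ₀.toFun A₀))) := by
  have htrA := (hlim.tendsto_traceENN hA₀.2.traceENN_ne_top).mono_left hU
  obtain ⟨x, x₀, hx, hx₀, hxlim, hxent, hxent₀⟩ := exists_tendsto_isDec_ent U
    (fun n => (hA n).1) hA₀.1 (fun n => (hA n).2.traceENN_ne_top) hA₀.2.traceENN_ne_top
    (fun y => (hlim.tendsto_qf y).mono_left hU) htrA (hH.mono_left hU)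
  have hBlim : ∀ j, Tendsto (fun n => qEntropy ((Φ n).toFun (rankOne (x n j)))) U
      (𝓝 (qEntropy (Φ₀.toFun (rankOne (x₀ j))))) := fun j =>
    tendsto_apply_of_tendsto_prod
      (f := fun n z => qEntropy ((Φ n).toFun (rankOne z))) (hjoint (x₀ j)) hU (hxlim j)
  have hqlim : ∀ j, Tendsto (fun n => traceENN ((Φ n).toFun (rankOne (x n j)))) U
      (𝓝 (traceENN (Φ₀.toFun (rankOne (x₀ j))))) := fun j =>
    tendsto_traceENN_map_rankOne hTNI hconv hU (hxlim j)
  have hdec := fun j => exists_tendsto_isDec_ent U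
    (B := fun n => (Φ n).toFun (rankOne (x n j))) (B₀ := Φ₀.toFun (rankOne (x₀ j)))
    (fun n => (Φ n).isPositive_rankOne (x n j)) (Φ₀.isPositive_rankOne (x₀ j))
    (fun n => ((Φ n).maps_tc _ (isTC_rankOne (x n j))).traceENN_ne_top)
    (Φ₀.maps_tc _ (isTC_rankOne (x₀ j))).traceENN_ne_top
    (tendsto_qf_map_rankOne hTNI hconv hU (hxlim j)) (hqlim j) (hBlim j)
  choose y y₀ hy hy₀ hylim hyent hyent₀ using hdec
  have hqlim' : ∀ j, Tendsto (fun n => ∑' i, ‖y j n i‖ₑ ^ 2) U (𝓝 (∑' i, ‖y₀ j i‖ₑ ^ 2)) :=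
    fun j => by simpa only [(hy j _).traceENN_eq, (hy₀ j).traceENN_eq] using hqlim j
  have hqp : ∀ n j, ∑' i, ‖y j n i‖ₑ ^ 2 ≤ ‖x n j‖ₑ ^ 2 := fun n j => by
    rw [← (hy j n).traceENN_eq]
    exact (hTNI n).traceENN_rankOne_le (x n j)
  have hqp₀ : ∀ j, ∑' i, ‖y₀ j i‖ₑ ^ 2 ≤ ‖x₀ j‖ₑ ^ 2 := fun j => by
    rw [← (hy₀ j).traceENN_eq]
    exact hTNI₀.traceENN_rankOne_le (x₀ j)
  have hP : ∀ n, ∑' j, ‖x n j‖ₑ ^ 2 ≠ ∞ := fun n => by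
    rw [← (hx n).traceENN_eq]
    exact (hA n).2.traceENN_ne_top
  have hP₀ : ∑' j, ‖x₀ j‖ₑ ^ 2 ≠ ∞ := by
    rw [← hx₀.traceENN_eq]
    exact hA₀.2.traceENN_ne_top
  have hQ : ∀ n, ∑' j, ∑' i, ‖y j n i‖ₑ ^ 2 ≠ ∞ := fun n =>
    ne_top_of_le_ne_top (hP n) (ENNReal.tsum_le_tsum (hqp n))
  have hQ₀ : ∑' j, ∑' i, ‖y₀ j i‖ₑ ^ 2 ≠ ∞ :=
    ne_top_of_le_ne_top hP₀ (ENNReal.tsum_le_tsum hqp₀)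
  obtain ⟨C, hC, hbound⟩ := exists_qEntropy_map_rankOne_le (hjoint 0)
  obtain ⟨hQlim, hFlim, hFfin⟩ := tendsto_tsum_entTerm_add (l := (U : Filter ℕ)) hC
    (fun j => tendsto_enorm_sq U (hxlim j)) hqlim' hBlim hqp
    ((hbound.filter_mono hU).mono fun n hn j => hn (x n j))
    (by simpa only [(hx _).traceENN_eq, hx₀.traceENN_eq] using htrA) hP hP₀
    (by simpa only [hxent, hxent₀] using hH.mono_left hU) (hxent₀ ▸ hH₀)
  have hzent : ∀ n, (ent fun k : ℕ × ℕ => ‖y k.1 n k.2‖ₑ ^ 2) =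
      ∑' j, (entTerm (∑' j, ∑' i, ‖y j n i‖ₑ ^ 2) (∑' i, ‖y j n i‖ₑ ^ 2) +
        qEntropy ((Φ n).toFun (rankOne (x n j)))) := fun n => by
    rw [ent_prod (fun j i => ‖y j n i‖ₑ ^ 2) (hQ n)]
    exact tsum_congr fun j => congrArg _ (hyent j n).symm
  have hzent₀ : (ent fun k : ℕ × ℕ => ‖y₀ k.1 k.2‖ₑ ^ 2) =
      ∑' j, (entTerm (∑' j, ∑' i, ‖y₀ j i‖ₑ ^ 2) (∑' i, ‖y₀ j i‖ₑ ^ 2) +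
        qEntropy (Φ₀.toFun (rankOne (x₀ j)))) := by
    rw [ent_prod (fun j i => ‖y₀ j i‖ₑ ^ 2) hQ₀]
    exact tsum_congr fun j => congrArg _ (hyent₀ j).symm
  have hzsum : ∀ n, ∑' k : ℕ × ℕ, ‖y k.1 n k.2‖ₑ ^ 2 = ∑' j, ∑' i, ‖y j n i‖ₑ ^ 2 := fun n =>
    ENNReal.tsum_prod (f := fun j i => ‖y j n i‖ₑ ^ 2)
  have hzsum₀ : ∑' k : ℕ × ℕ, ‖y₀ k.1 k.2‖ₑ ^ 2 = ∑' j, ∑' i, ‖y₀ j i‖ₑ ^ 2 :=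
    ENNReal.tsum_prod (f := fun j i => ‖y₀ j i‖ₑ ^ 2)
  have hz := fun n => (hTNI n).isDec_map (hA n) (hx n) fun j => hy j n
  have hz₀ := hTNI₀.isDec_map hA₀ hx₀ hy₀
  have hpos := fun n => (Φ n).pos _ (hA n).2 (hA n).1
  have hpos₀ := Φ₀.pos _ hA₀.2 hA₀.1
  refine ⟨ne_top_of_le_ne_top (hzent₀ ▸ hFfin) (hz₀.qEntropy_le hpos₀ (hzsum₀ ▸ hQ₀)), ?_⟩
  exact tendsto_qEntropy_of_isDec U hpos hpos₀ hz hz₀ (fun k => hylim k.1 k.2)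
    (by simpa only [hzsum, hzsum₀] using hQlim) (fun n => hzsum n ▸ hQ n) (hzsum₀ ▸ hQ₀)
    (by simpa only [hzent, hzent₀] using hFlim) (hzent₀ ▸ hFfin)

end OutputEntropy

section RankCone

variable {E : Type*} [NormedAddCommGroup E] [InnerProductSpace ℂ E] [CompleteSpace E]

theorem rankOne_mem_rankCone (x : E) : rankOne x ∈ rankCone E 1 := by
  refine ⟨rankOne_isPositive x, ?_⟩
  rw [rankLE, Nat.cast_one, rank_submodule_le_one_iff']
  refine ⟨x, ?_⟩
  rintro _ ⟨y, rfl⟩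
  exact Submodule.mem_span_singleton.2 ⟨_, rfl⟩

theorem rankOne_mem_posTC (x : E) : rankOne x ∈ posTC E :=
  ⟨rankOne_isPositive x, isTC_rankOne x⟩

theorem inner_mul_inner_of_rankLE_one {A : E →L[ℂ] E} (hA : rankLE A 1) (u v y : E) :
    (inner ℂ y (A y) * inner ℂ u (A v) : ℂ) = inner ℂ y (A v) * inner ℂ u (A y) := by
  rw [rankLE, Nat.cast_one, rank_submodule_le_one_iff'] at hA
  obtain ⟨w, hw⟩ := hA
  obtain ⟨a, ha⟩ := Submodule.mem_span_singleton.1 (hw ⟨y, rfl⟩)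
  obtain ⟨b, hb⟩ := Submodule.mem_span_singleton.1 (hw ⟨v, rfl⟩)
  have ha' : A y = a • w := ha.symm
  have hb' : A v = b • w := hb.symm
  rw [ha', hb']
  simp only [inner_smul_right]
  ring

theorem exists_eq_rankOne {A : E →L[ℂ] E} (hA : A.IsPositive)
    (h : ∀ u v y : E,
      (inner ℂ y (A y) * inner ℂ u (A v) : ℂ) = inner ℂ y (A v) * inner ℂ u (A y)) :
    ∃ x, A = rankOne x := by
  have hreal : ∀ y, (inner ℂ y (A y) : ℂ) = ((qf A y : ℝ) : ℂ) := fun y =>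
    (hA.isSelfAdjoint.isSymmetric.coe_re_inner_self_apply y).symm
  by_cases h0 : ∀ y, (inner ℂ y (A y) : ℂ) = 0
  · refine ⟨0, ?_⟩
    rw [rankOne_zero]
    refine ContinuousLinearMap.coe_inj.1 ((inner_map_self_eq_zero (A : E →ₗ[ℂ] E)).1 fun y => ?_)
    exact (hA.isSelfAdjoint.isSymmetric y y).trans (h0 y)
  push Not at h0
  obtain ⟨y, hy⟩ := h0
  have ht : 0 < qf A y := (qf_nonneg hA y).lt_of_ne fun h' => hy (by rw [hreal, ← h']; simp)
  refine ⟨((√(qf A y)⁻¹ : ℝ) : ℂ) • A y, ?_⟩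
  rw [rankOne_smul, Real.sq_sqrt (by positivity)]
  ext v
  refine ext_inner_left ℂ fun u => ?_
  have hsym : (inner ℂ (A y) v : ℂ) = inner ℂ y (A v) := hA.isSelfAdjoint.isSymmetric y v
  rw [smul_apply, inner_smul_right, inner_rankOne, hsym, ← h, hreal, ← mul_assoc,
    ← Complex.ofReal_mul, inv_mul_cancel₀ ht.ne', Complex.ofReal_one, one_mul]

theorem TendstoTN.isPositive {A : ℕ → E →L[ℂ] E} {A₀ : E →L[ℂ] E} (h : TendstoTN A A₀)
    (hA : ∀ n, (A n).IsPositive) : A₀.IsPositive := by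
  refine ⟨fun x y => ?_, fun x => ?_⟩
  · have h1 : Tendsto (fun n => (inner ℂ (A n x) y : ℂ)) atTop (𝓝 (inner ℂ (A₀ x) y)) := by
      simpa only [Function.comp_def, inner_conj_symm] using
        (Complex.continuous_conj.tendsto _).comp (h.tendsto_inner y x)
    refine tendsto_nhds_unique h1 ((h.tendsto_inner x y).congr fun n => ?_)
    exact ((hA n).isSelfAdjoint.isSymmetric x y).symm
  · rw [ContinuousLinearMap.reApplyInnerSelf_apply, inner_re_symm]
    exact ge_of_tendsto' (h.tendsto_qf x) fun n => qf_nonneg (hA n) x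

theorem TendstoTN.exists_eq_rankOne {A : ℕ → E →L[ℂ] E} {A₀ : E →L[ℂ] E} (h : TendstoTN A A₀)
    (hA : ∀ n, A n ∈ rankCone E 1) : ∃ x, A₀ = rankOne x := by
  refine QIT.exists_eq_rankOne (h.isPositive fun n => (hA n).1) fun u v y => ?_
  refine tendsto_nhds_unique ((h.tendsto_inner y y).mul (h.tendsto_inner u v))
    (((h.tendsto_inner y v).mul (h.tendsto_inner u y)).congr fun n => ?_)
  exact (inner_mul_inner_of_rankLE_one (hA n).2 u v y).symm

end RankCone

/-- Proposition 8 of the paper. Let `{Φₙ}` be a sequence of positive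
linear trace-non-increasing maps strongly converging to `Φ₀`.  Then convergence
`H_{Φₙ}(Aₙ) → H_{Φ₀}(A₀) < ∞` for every trace-norm converging sequence of positive
rank-≤1 operators is equivalent to the same convergence for every trace-norm converging
sequence `{Aₙ} ⊆ 𝔗₊(ℋ)` with `H(Aₙ) → H(A₀) < ∞`. -/
theorem statement17
    {E F : Type*}
    [NormedAddCommGroup E] [InnerProductSpace ℂ E] [CompleteSpace E]
    [TopologicalSpace.SeparableSpace E]
    [NormedAddCommGroup F] [InnerProductSpace ℂ F] [CompleteSpace F]
    [TopologicalSpace.SeparableSpace F]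
    (Φ : ℕ → TraceMap E F) (Φ₀ : TraceMap E F)
    (hTNI : ∀ n, (Φ n).TNI) (hTNI₀ : Φ₀.TNI)
    (hconv : ∀ ρ ∈ states E, TendstoTN (fun n => (Φ n).toFun ρ) (Φ₀.toFun ρ)) :
    (∀ (A : ℕ → (E →L[ℂ] E)) (A₀ : E →L[ℂ] E),
        (∀ n, A n ∈ rankCone E 1) → TendstoTN A A₀ →
        (qEntropy (Φ₀.toFun A₀) ≠ ∞ ∧
          Tendsto (fun n => qEntropy ((Φ n).toFun (A n))) atTop
            (nhds (qEntropy (Φ₀.toFun A₀))))) ↔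
    (∀ (A : ℕ → (E →L[ℂ] E)) (A₀ : E →L[ℂ] E),
        (∀ n, A n ∈ posTC E) → A₀ ∈ posTC E → TendstoTN A A₀ →
        qEntropy A₀ ≠ ∞ →
        Tendsto (fun n => qEntropy (A n)) atTop (nhds (qEntropy A₀)) →
        (qEntropy (Φ₀.toFun A₀) ≠ ∞ ∧
          Tendsto (fun n => qEntropy ((Φ n).toFun (A n))) atTop
            (nhds (qEntropy (Φ₀.toFun A₀))))) := by
  constructor
  · intro hi A A₀ hA hA₀ hlim hH₀ hH
    have hjoint : ∀ x₀ : E, Tendsto (fun p : ℕ × E => qEntropy ((Φ p.1).toFun (rankOne p.2)))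
        (atTop ×ˢ 𝓝 x₀) (𝓝 (qEntropy (Φ₀.toFun (rankOne x₀)))) := fun x₀ =>
      tendsto_prod_of_forall_seq (f := fun n x => qEntropy ((Φ n).toFun (rankOne x)))
        fun x hx => (hi (fun n => rankOne (x n)) (rankOne x₀)
          (fun n => rankOne_mem_rankCone (x n)) (tendstoTN_rankOne hx)).2
    have hU := tendsto_qEntropy_map_ultrafilter hTNI hTNI₀ hconv hjoint hA hA₀ hlim hH₀ hH
    exact ⟨(hU (Ultrafilter.of atTop) (Ultrafilter.of_le atTop)).1,
      tendsto_iff_ultrafilter _ _ _ |>.2 fun U hle => (hU U hle).2⟩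
  · intro hii A A₀ hA hlim
    have hrank : ∀ n, ∃ x, A n = rankOne x := fun n =>
      exists_eq_rankOne (hA n).1 (inner_mul_inner_of_rankLE_one (hA n).2)
    choose x hx using hrank
    obtain ⟨x₀, rfl⟩ := hlim.exists_eq_rankOne hA
    refine hii A (rankOne x₀) (fun n => hx n ▸ rankOne_mem_posTC (x n)) (rankOne_mem_posTC x₀) hlim
      (by simp [qEntropy_rankOne]) ?_
    simp [hx, qEntropy_rankOne]

end QIT
end
end

section
/- Let {π_i}_{i=1}^{∞} be a sequence of positive numbers. Then the supremum of the classical entropy H({π_i x_i}_{i=1}^{∞}) over all probability distributions {x_i}_{i=1}^{∞} (x_i ≥ 0, Σ_i x_i = 1) equals λ*, where λ* is the unique finite solution of the equation Σ_{i=1}^{∞} e^{−λ/π_i} = 1 if such a solution exists, and otherwise λ* = g({π_i^{−1}}) := inf{λ > 0 | Σ_{i=1}^{∞} e^{−λ/π_i} < +∞} (with inf ∅ = +∞). -/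
open scoped ENNReal NNReal
open Filter Topology Classical
attribute [local instance] Classical.propDecidable

noncomputable section

namespace QIT

/-- The pointwise Gibbs inequality. -/
theorem negMulLog_le_mul_add_exp_neg_sub {y : ℝ} (hy : 0 ≤ y) (a : ℝ) :
    Real.negMulLog y ≤ y * a + (Real.exp (-a) - y) := by
  rcases hy.eq_or_lt with rfl | hy
  · simpa using (Real.exp_pos (-a)).le
  · have h := Real.log_le_sub_one_of_pos (div_pos (Real.exp_pos (-a)) hy)
    rw [Real.log_div (Real.exp_pos _).ne' hy.ne', Real.log_exp] at h
    have h2 := mul_le_mul_of_nonneg_left h hy.le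
    have h3 : y * (Real.exp (-a) / y - 1) = Real.exp (-a) - y := by field_simp
    rw [h3] at h2
    rw [Real.negMulLog]
    linarith

/-- If `∑ e^{-l/πᵢ} ≤ 1`, then `l` bounds the entropy of `{πᵢxᵢ}` for every distribution `x`. -/
theorem clEntropy_mul_le {ι : Type*} {π x : ι → ℝ} (hπ : ∀ i, 0 < π i) (hx : ∀ i, 0 ≤ x i)
    (hx1 : HasSum x 1) {l : ℝ} (hl : ∑' i, ENNReal.ofReal (Real.exp (-(l / π i))) ≤ 1) :
    clEntropy (fun i => π i * x i) ≤ ENNReal.ofReal l := by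
  rw [clEntropy]
  by_cases hs : Summable fun i => π i * x i
  swap
  · simp [tsum_eq_zero_of_not_summable hs]
  have hnn : ∀ i, 0 ≤ π i * x i := fun i => mul_nonneg (hπ i).le (hx i)
  set S := ∑' i, π i * x i with hS
  have hSpos : 0 < S := by
    obtain ⟨i, hi⟩ : ∃ i, x i ≠ 0 := by
      by_contra! h
      have : x = fun _ => 0 := funext h
      subst this
      exact zero_ne_one (hasSum_zero.unique hx1)
    exact hs.tsum_pos hnn i (mul_pos (hπ i) ((hx i).lt_of_ne' hi))
  have hexp : Summable fun i => Real.exp (-(l / π i)) := by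
    have := ENNReal.summable_toReal (ne_top_of_le_ne_top ENNReal.one_ne_top hl)
    simpa [ENNReal.toReal_ofReal, Real.exp_nonneg] using this
  have hZ : ∑' i, Real.exp (-(l / π i)) ≤ 1 := by
    rw [← ENNReal.ofReal_tsum_of_nonneg (fun _ => Real.exp_nonneg _) hexp] at hl
    simpa using hl
  have hy : HasSum (fun i => π i * x i / S) 1 := by
    simpa only [← hS, div_self hSpos.ne'] using hs.hasSum.div_const S
  have hyl : HasSum (fun i => π i * x i / S * (l / π i)) (l / S) := by
    have h := hx1.mul_right (l / S)
    rw [one_mul] at h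
    refine h.congr_fun fun i => ?_
    have := (hπ i).ne'
    field_simp
  have hb := hyl.add (hexp.hasSum.sub hy)
  have hle : ∀ i, Real.negMulLog (π i * x i / S) ≤
      π i * x i / S * (l / π i) + (Real.exp (-(l / π i)) - π i * x i / S) := fun i =>
    negMulLog_le_mul_add_exp_neg_sub (div_nonneg (hnn i) hSpos.le) _
  have hnonneg : ∀ i, 0 ≤ Real.negMulLog (π i * x i / S) := fun i =>
    Real.negMulLog_nonneg (div_nonneg (hnn i) hSpos.le)
      (le_hasSum hy i fun j _ => div_nonneg (hnn j) hSpos.le)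
  calc ENNReal.ofReal S * ∑' i, ENNReal.ofReal (Real.negMulLog (π i * x i / S))
      ≤ ENNReal.ofReal S * ∑' i, ENNReal.ofReal
          (π i * x i / S * (l / π i) + (Real.exp (-(l / π i)) - π i * x i / S)) := by
        gcongr with i
        exact hle i
    _ = ENNReal.ofReal (S * (l / S + (∑' i, Real.exp (-(l / π i)) - 1))) := by
        rw [← ENNReal.ofReal_tsum_of_nonneg (fun i => (hnonneg i).trans (hle i)) hb.summable,
          hb.tsum_eq, ← ENNReal.ofReal_mul hSpos.le]
    _ ≤ ENNReal.ofReal l := by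
        apply ENNReal.ofReal_le_ofReal
        have : S * (l / S) = l := by field_simp
        nlinarith

/-- A finite Gibbs distribution attains the value `l` of the entropy of `{πᵢxᵢ}`. -/
theorem exists_clEntropy_mul_eq {ι : Type*} {π : ι → ℝ} (hπ : ∀ i, 0 < π i) {l : ℝ}
    {s : Finset ι} (hs : ∑ i ∈ s, Real.exp (-(l / π i)) = 1) :
    ∃ x : ι → ℝ, ((∀ i, 0 ≤ x i) ∧ HasSum x 1) ∧
      clEntropy (fun i => π i * x i) = ENNReal.ofReal l := by
  have hne : s.Nonempty := by
    by_contra h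
    simp [Finset.not_nonempty_iff_eq_empty.mp h] at hs
  set T := ∑ i ∈ s, Real.exp (-(l / π i)) / π i with hT
  have hTpos : 0 < T := Finset.sum_pos (fun i _ => div_pos (Real.exp_pos _) (hπ i)) hne
  let x : ι → ℝ := fun i => if i ∈ s then Real.exp (-(l / π i)) / π i / T else 0
  have hprod : ∀ i, π i * x i = (if i ∈ s then Real.exp (-(l / π i)) else 0) / T := by
    intro i
    have := (hπ i).ne'
    by_cases hi : i ∈ s
    · simp only [x, hi, if_true]
      field_simp
    · simp [x, hi]
  have hsum : ∑' i, π i * x i = 1 / T := by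
    simp_rw [hprod]
    rw [tsum_div_const, tsum_eq_sum (s := s) (fun i hi => by simp [hi]),
      Finset.sum_congr rfl (fun i hi => if_pos hi), hs]
  refine ⟨x, ⟨fun i => ?_, ?_⟩, ?_⟩
  · have := hπ i
    simp only [x]
    split_ifs <;> positivity
  · have h : ∑ i ∈ s, x i = 1 := by
      rw [Finset.sum_congr rfl (fun i hi => if_pos hi), ← Finset.sum_div, ← hT,
        div_self hTpos.ne']
    rw [← h]
    exact hasSum_sum_of_ne_finset_zero fun i hi => if_neg hi
  · have hratio : ∀ i, π i * x i / (1 / T) = if i ∈ s then Real.exp (-(l / π i)) else 0 := by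
      intro i
      rw [hprod]
      field_simp
    have hnonneg : ∀ i ∈ s, 0 ≤ Real.negMulLog (Real.exp (-(l / π i))) := fun i hi =>
      Real.negMulLog_nonneg (Real.exp_nonneg _)
        (hs ▸ Finset.single_le_sum (f := fun i => Real.exp (-(l / π i)))
          (fun j _ => Real.exp_nonneg _) hi)
    rw [clEntropy, hsum]
    simp_rw [hratio]
    rw [tsum_eq_sum (s := s) (fun i hi => by simp [hi]),
      Finset.sum_congr rfl (fun i hi => by rw [if_pos hi]),
      ← ENNReal.ofReal_sum_of_nonneg hnonneg, ← ENNReal.ofReal_mul (by positivity)]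
    have h : ∑ i ∈ s, Real.negMulLog (Real.exp (-(l / π i))) = l * T := by
      rw [hT, Finset.mul_sum]
      refine Finset.sum_congr rfl fun i _ => ?_
      rw [Real.negMulLog, Real.log_exp]
      ring
    rw [h]
    congr 1
    field_simp

/-- If `∑ e^{-l/πᵢ}` is finite and exceeds `1`, the equation `∑ e^{-m/πᵢ} = 1` is solvable
to the right of `l`. -/
theorem exists_tsum_exp_neg_div_eq_one {ι : Type*} {π : ι → ℝ} (hπ : ∀ i, 0 < π i) {l : ℝ}
    (hsum : Summable fun i => Real.exp (-(l / π i)))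
    (hl : 1 < ∑' i, Real.exp (-(l / π i))) :
    ∃ m, l ≤ m ∧ (Summable fun i => Real.exp (-(m / π i))) ∧
      ∑' i, Real.exp (-(m / π i)) = 1 := by
  have hbound : ∀ i, ∀ m ∈ Set.Ici l, ‖Real.exp (-(m / π i))‖ ≤ Real.exp (-(l / π i)) := by
    intro i m hm
    rw [Real.norm_of_nonneg (Real.exp_nonneg _)]
    have := hπ i
    have hm' : l ≤ m := hm
    gcongr
  have hcont : ContinuousOn (fun m => ∑' i, Real.exp (-(m / π i))) (Set.Ici l) :=
    continuousOn_tsum (fun i => by fun_prop) hsum hbound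
  have hlim : Tendsto (fun m => ∑' i, Real.exp (-(m / π i))) atTop (𝓝 0) := by
    have h := tendsto_tsum_of_dominated_convergence (𝓕 := atTop)
      (f := fun (m : ℝ) i => Real.exp (-(m / π i))) (g := fun _ => (0 : ℝ)) hsum
      (fun i => Real.tendsto_exp_neg_atTop_nhds_zero.comp (tendsto_id.atTop_div_const (hπ i)))
      (by filter_upwards [eventually_ge_atTop l] with m hm i using hbound i m hm)
    simpa using h
  obtain ⟨u, hu, hlu⟩ :=
    ((hlim.eventually (gt_mem_nhds one_pos)).and (eventually_ge_atTop l)).exists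
  obtain ⟨m, hm, hm1⟩ := intermediate_value_Icc' hlu
    (hcont.mono Set.Icc_subset_Ici_self) ⟨hu.le, hl.le⟩
  exact ⟨m, hm.1, hsum.of_norm_bounded fun i => hbound i m hm.1, hm1⟩

/-- If `∑ e^{-l/πᵢ} > 1` (possibly infinite), the supremum of the entropy of `{πᵢxᵢ}` is at
least `l`. -/
theorem le_iSup_clEntropy_mul {ι : Type*} {π : ι → ℝ} (hπ : ∀ i, 0 < π i) {l : ℝ}
    (hl : 1 < ∑' i, ENNReal.ofReal (Real.exp (-(l / π i)))) :
    ENNReal.ofReal l ≤ ⨆ (x : ι → ℝ) (_ : (∀ i, 0 ≤ x i) ∧ HasSum x 1),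
      clEntropy fun i => π i * x i := by
  rw [ENNReal.tsum_eq_iSup_sum] at hl
  obtain ⟨s, hs⟩ := lt_iSup_iff.mp hl
  rw [← ENNReal.ofReal_sum_of_nonneg (fun _ _ => Real.exp_nonneg _),
    ENNReal.one_lt_ofReal] at hs
  obtain ⟨m, hlm, -, hm⟩ := exists_tsum_exp_neg_div_eq_one (π := fun i : s => π i)
    (fun i => hπ i) (l := l) (Summable.of_finite)
    (by rwa [Finset.tsum_subtype s fun i => Real.exp (-(l / π i))])
  rw [Finset.tsum_subtype s fun i => Real.exp (-(m / π i))] at hm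
  obtain ⟨x, hx, hxm⟩ := exists_clEntropy_mul_eq hπ hm
  calc ENNReal.ofReal l ≤ ENNReal.ofReal m := ENNReal.ofReal_le_ofReal hlm
    _ = clEntropy (fun i => π i * x i) := hxm.symm
    _ ≤ _ := le_iSup₂ (f := fun (x : ι → ℝ) (_ : (∀ i, 0 ≤ x i) ∧ HasSum x 1) =>
        clEntropy fun i => π i * x i) x hx

/-- Lemma 5 of the paper. For a sequence `{πᵢ}` of positive numbers,
`sup_{x ∈ 𝔓} H({πᵢxᵢ}) = λ*`, where the supremum is over all probability distributions
`{xᵢ}`, and `λ*` is the unique solution of `∑ᵢ e^{−λ/πᵢ} = 1` if it exists and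
`inf{λ > 0 | ∑ᵢ e^{−λ/πᵢ} < ∞}` (with `inf ∅ = ∞`) otherwise. -/
theorem statement19 (π : ℕ → ℝ) (hπ : ∀ i, 0 < π i) :
    (∀ l : ℝ, (∑' i, ENNReal.ofReal (Real.exp (-(l / π i)))) = 1 →
      (⨆ (x : ℕ → ℝ) (_ : (∀ i, 0 ≤ x i) ∧ HasSum x 1),
          clEntropy fun i => π i * x i) = ENNReal.ofReal l) ∧
    ((¬ ∃ l : ℝ, (∑' i, ENNReal.ofReal (Real.exp (-(l / π i)))) = 1) →
      (⨆ (x : ℕ → ℝ) (_ : (∀ i, 0 ≤ x i) ∧ HasSum x 1),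
          clEntropy fun i => π i * x i) =
        ⨅ (l : ℝ) (_ : 0 < l ∧ (∑' i, ENNReal.ofReal (Real.exp (-(l / π i)))) ≠ ∞),
          ENNReal.ofReal l) := by
  constructor
  · intro l hl
    refine le_antisymm (iSup₂_le fun x hx => clEntropy_mul_le hπ hx.1 hx.2 hl.le) ?_
    have hlt : ∀ m < l, ENNReal.ofReal m ≤ ⨆ (x : ℕ → ℝ)
        (_ : (∀ i, 0 ≤ x i) ∧ HasSum x 1), clEntropy fun i => π i * x i := by
      intro m hm
      apply le_iSup_clEntropy_mul hπ
      have hterm : ∀ i, Real.exp (-(l / π i)) < Real.exp (-(m / π i)) := fun i => by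
        have := hπ i
        gcongr
      rw [← hl]
      exact ENNReal.tsum_lt_tsum (by simp [hl])
        (fun i => ENNReal.ofReal_le_ofReal (hterm i).le) (i := 0)
        ((ENNReal.ofReal_lt_ofReal_iff (Real.exp_pos _)).mpr (hterm 0))
    exact le_of_tendsto ((ENNReal.continuous_ofReal.tendsto l).mono_left nhdsWithin_le_nhds)
      (eventually_nhdsWithin_of_forall (s := Set.Iio l) hlt)
  · intro hno
    apply le_antisymm
    · refine le_iInf₂ fun l hl => ?_
      rcases le_or_gt (∑' i, ENNReal.ofReal (Real.exp (-(l / π i)))) 1 with h | h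
      · exact iSup₂_le fun x hx => clEntropy_mul_le hπ hx.1 hx.2 h
      · have hexp : Summable fun i => Real.exp (-(l / π i)) := by
          simpa [ENNReal.toReal_ofReal, Real.exp_nonneg] using ENNReal.summable_toReal hl.2
        rw [← ENNReal.ofReal_tsum_of_nonneg (fun _ => Real.exp_nonneg _) hexp,
          ENNReal.one_lt_ofReal] at h
        obtain ⟨m, -, hms, hm⟩ := exists_tsum_exp_neg_div_eq_one hπ hexp h
        refine absurd ⟨m, ?_⟩ hno
        rw [← ENNReal.ofReal_tsum_of_nonneg (fun _ => Real.exp_nonneg _) hms, hm,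
          ENNReal.ofReal_one]
    · refine ENNReal.le_of_forall_nnreal_lt fun c hc => ?_
      rcases eq_or_ne c 0 with rfl | hc0
      · simp
      · rw [← ENNReal.ofReal_coe_nnreal]
        apply le_iSup_clEntropy_mul hπ
        by_contra! h
        refine hc.not_ge (iInf₂_le_of_le (c : ℝ) ⟨?_, ?_⟩ ENNReal.ofReal_coe_nnreal.le)
        · exact_mod_cast pos_iff_ne_zero.mpr hc0
        · exact ne_top_of_le_ne_top ENNReal.one_ne_top h

end QIT
end
end
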